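/- arXiv:1610.01008 — 2 statements merged into one kernel-verified Lean document; each statement's English description precedes it below -/
import Mathlib

section
/- Let 1 < p < ∞ and 1 < q ≤ ∞. There exists C > 0 such that for every sequence (f_k)_{k ∈ ℕ_0^d} of locally integrable functions on ℝ^d, ‖ (∑_k (M f_k)^q)^{1/q} ‖_{L^p(ℝ^d)} ≤ C ‖ (∑_k |f_k|^q)^{1/q} ‖_{L^p(ℝ^d)}, where M is the Hardy–Littlewood maximal operator with respect to axis-parallel cubes. -/
open MeasureTheory ENNReal

/-- ℓ^q norm (with q = ∞ interpreted as supremum) of an ℝ≥0∞-valued family. -/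
noncomputable def lqNorm {ι : Type*} (q : ℝ≥0∞) (g : ι → ℝ≥0∞) : ℝ≥0∞ :=
  if q = ∞ then ⨆ k, g k else (∑' k, g k ^ q.toReal) ^ (1 / q.toReal)

/-- Hardy–Littlewood maximal operator with respect to axis-parallel cubes. -/
noncomputable def cubeMaximal {d : ℕ} (f : (Fin d → ℝ) → ℂ) (x : Fin d → ℝ) : ℝ≥0∞ :=
  ⨆ (a : Fin d → ℝ) (s : ℝ) (_ : 0 < s ∧ x ∈ Set.Icc a (a + Function.const _ s)),
    (∫⁻ y in Set.Icc a (a + Function.const _ s), (‖f y‖₊ : ℝ≥0∞)) /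
      volume (Set.Icc a (a + Function.const _ s))


namespace FS

/-- Countable index set of balls with rational centers and radii. -/
abbrev Idx (d : ℕ) := (Fin d → ℚ) × {r : ℚ // 0 < r}

def cen {d : ℕ} (i : Idx d) : Fin d → ℝ := fun j => (i.1 j : ℝ)

def rad {d : ℕ} (i : Idx d) : ℝ := ((i.2 : ℚ) : ℝ)

lemma rad_pos {d : ℕ} (i : Idx d) : 0 < rad i := by
  have := i.2.2
  unfold rad
  exact_mod_cast this

def bal {d : ℕ} (i : Idx d) : Set (Fin d → ℝ) := Metric.closedBall (cen i) (rad i)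

def bal5 {d : ℕ} (i : Idx d) : Set (Fin d → ℝ) := Metric.closedBall (cen i) (5 * rad i)

lemma meas_bal {d : ℕ} (i : Idx d) : MeasurableSet (bal i) := Metric.isClosed_closedBall.measurableSet

/-- generic maximal operator -/
noncomputable def TT {d : ℕ} (a : Idx d → ℝ≥0∞) (m : Measure (Fin d → ℝ)) (f : (Fin d → ℝ) → ℝ≥0∞)
    (x : Fin d → ℝ) : ℝ≥0∞ :=
  ⨆ i, (bal i).indicator (fun _ => a i * ∫⁻ y in bal i, f y ∂m) x

lemma meas_TT {d : ℕ} (a : Idx d → ℝ≥0∞) (m : Measure (Fin d → ℝ)) (f : (Fin d → ℝ) → ℝ≥0∞) :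
    Measurable (TT a m f) := by
  unfold TT
  exact Measurable.iSup fun i => measurable_const.indicator (meas_bal i)

lemma lt_TT {d : ℕ} {a : Idx d → ℝ≥0∞} {m : Measure (Fin d → ℝ)} {f : (Fin d → ℝ) → ℝ≥0∞}
    {x : Fin d → ℝ} {t : ℝ≥0∞} :
    t < TT a m f x ↔ ∃ i, x ∈ bal i ∧ t < a i * ∫⁻ y in bal i, f y ∂m := by
  unfold TT
  rw [lt_iSup_iff]
  refine exists_congr fun i => ?_
  by_cases h : x ∈ bal i <;> simp [h]

lemma le_TT {d : ℕ} (a : Idx d → ℝ≥0∞) (m : Measure (Fin d → ℝ)) (f : (Fin d → ℝ) → ℝ≥0∞)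
    {x : Fin d → ℝ} (i : Idx d) (hx : x ∈ bal i) :
    a i * ∫⁻ y in bal i, f y ∂m ≤ TT a m f x := by
  unfold TT
  refine le_trans (le_of_eq ?_) (le_iSup _ i)
  simp [hx]

lemma TT_le {d : ℕ} {a : Idx d → ℝ≥0∞} {m : Measure (Fin d → ℝ)} {f : (Fin d → ℝ) → ℝ≥0∞}
    {x : Fin d → ℝ} {t : ℝ≥0∞} (h : ∀ i, x ∈ bal i → a i * ∫⁻ y in bal i, f y ∂m ≤ t) :
    TT a m f x ≤ t := by
  unfold TT
  refine iSup_le fun i => ?_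
  by_cases hx : x ∈ bal i
  · simpa [hx] using h i hx
  · simp [hx]

lemma weak {d : ℕ} (a : Idx d → ℝ≥0∞) (m μ ν : Measure (Fin d → ℝ)) (C : ℝ≥0∞)
    (f : (Fin d → ℝ) → ℝ≥0∞)
    (h : ∀ i, μ (bal5 i) * (a i * ∫⁻ y in bal i, f y ∂m) ≤ C * ∫⁻ y in bal i, f y ∂ν)
    (t : ℝ≥0∞) :
    t * μ {x | t < TT a m f x} ≤ C * ∫⁻ y, f y ∂ν := by
  let S : ℕ → Set (Idx d) := fun n => {i | t < a i * ∫⁻ y in bal i, f y ∂m ∧ rad i ≤ n}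
  have hU : {x | t < TT a m f x} = ⋃ n, ⋃ i ∈ S n, bal i := by
    ext x
    simp only [Set.mem_ofPred_eq, lt_TT, Set.mem_iUnion, S, exists_prop]
    constructor
    · rintro ⟨i, hx, hi⟩
      obtain ⟨n, hn⟩ := exists_nat_ge (rad i)
      exact ⟨n, i, ⟨hi, hn⟩, hx⟩
    · rintro ⟨n, i, ⟨hi, hn⟩, hx⟩
      exact ⟨i, hx, hi⟩
  have hmono : Monotone fun n => ⋃ i ∈ S n, bal i := by
    intro n k hnk
    refine Set.biUnion_subset_biUnion_left ?_
    rintro i ⟨h1, h2⟩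
    exact ⟨h1, h2.trans (by exact_mod_cast hnk)⟩
  rw [hU, hmono.measure_iUnion, ENNReal.mul_iSup]
  refine iSup_le fun n => ?_
  obtain ⟨u, huS, hdis, hcov⟩ := Vitali.exists_disjoint_subfamily_covering_enlargement_closedBall
    (S n) cen rad n (fun i hi => hi.2) 5 (by norm_num)
  have hsub : (⋃ i ∈ S n, bal i) ⊆ ⋃ i ∈ u, bal5 i := by
    intro x hx
    simp only [Set.mem_iUnion, exists_prop] at hx ⊢
    obtain ⟨i, hi, hx⟩ := hx
    obtain ⟨b, hb, hb2⟩ := hcov i hi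
    exact ⟨b, hb, hb2 hx⟩
  have huc : u.Countable := Set.to_countable u
  calc t * μ (⋃ i ∈ S n, bal i) ≤ t * μ (⋃ i ∈ u, bal5 i) := by gcongr
    _ ≤ t * ∑' i : u, μ (bal5 i.1) := by
        gcongr
        exact measure_biUnion_le μ huc _
    _ = ∑' i : u, t * μ (bal5 i.1) := ENNReal.tsum_mul_left.symm
    _ ≤ ∑' i : u, C * ∫⁻ y in bal i.1, f y ∂ν := by
        refine ENNReal.tsum_le_tsum fun i => ?_
        refine le_trans ?_ (h i.1)
        rw [mul_comm]
        gcongr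
        exact (huS i.2).1.le
    _ = C * ∑' i : u, ∫⁻ y in bal i.1, f y ∂ν := ENNReal.tsum_mul_left
    _ = C * ∫⁻ y in ⋃ i ∈ u, bal i, f y ∂ν := by
        rw [lintegral_biUnion huc (fun i _ => meas_bal i) hdis]
    _ ≤ C * ∫⁻ y, f y ∂ν := by
        gcongr
        exact Measure.restrict_le_self

lemma layer_fin (q : ℝ) (hq : 0 < q) (b : ℝ) (hb : 0 ≤ b) :
    ENNReal.ofReal q * ∫⁻ t in Set.Ioi (0:ℝ),
      (if ENNReal.ofReal t < ENNReal.ofReal b then ENNReal.ofReal (t ^ (q - 1)) else 0)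
      = ENNReal.ofReal b ^ q := by
  have h1 : ∫⁻ t in Set.Ioi (0:ℝ),
      (if ENNReal.ofReal t < ENNReal.ofReal b then ENNReal.ofReal (t ^ (q - 1)) else 0)
      = ∫⁻ t in Set.Ioc 0 b, ENNReal.ofReal (t ^ (q - 1)) := by
    rw [← restrict_Ioo_eq_restrict_Ioc, ← lintegral_indicator measurableSet_Ioi,
      ← lintegral_indicator measurableSet_Ioo]
    congr 1
    ext t
    by_cases ht : 0 < t
    · by_cases htb : t < b
      · have : ENNReal.ofReal t < ENNReal.ofReal b := (ENNReal.ofReal_lt_ofReal_iff_of_nonneg ht.le).2 htb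
        simp [Set.indicator, ht, htb, this]
      · have : ¬ ENNReal.ofReal t < ENNReal.ofReal b := by
          rw [ENNReal.ofReal_lt_ofReal_iff_of_nonneg ht.le]; exact htb
        simp only [Set.indicator, Set.mem_Ioi, ht, if_true, this, if_false, Set.mem_Ioo, htb, and_false]
    · simp [Set.indicator, ht]
  have hint : IntegrableOn (fun t : ℝ => t ^ (q - 1)) (Set.Ioc 0 b) := by
    rw [← intervalIntegrable_iff_integrableOn_Ioc_of_le hb]
    exact intervalIntegral.intervalIntegrable_rpow' (by linarith)
  rw [h1, ← ofReal_integral_eq_lintegral_ofReal hint, ← intervalIntegral.integral_of_le hb,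
    integral_rpow (Or.inl (by linarith)), ← ENNReal.ofReal_mul hq.le,
    ENNReal.ofReal_rpow_of_nonneg hb hq.le]
  · congr 1
    rw [sub_add_cancel, Real.zero_rpow hq.ne']
    field_simp
    ring
  · filter_upwards [ae_restrict_mem measurableSet_Ioc] with t ht
    exact Real.rpow_nonneg ht.1.le _

lemma layer (q : ℝ) (hq : 0 < q) (y : ℝ≥0∞) :
    ENNReal.ofReal q * ∫⁻ t in Set.Ioi (0:ℝ),
      (if ENNReal.ofReal t < y then ENNReal.ofReal (t ^ (q - 1)) else 0) = y ^ q := by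
  by_cases hy : y = ∞
  · subst hy
    rw [ENNReal.top_rpow_of_pos hq, eq_top_iff]
    refine ENNReal.le_of_forall_nnreal_lt fun r _ => ?_
    have := layer_fin q hq ((r:ℝ) ^ (1/q)) (by positivity)
    rw [ENNReal.ofReal_rpow_of_nonneg (by positivity) hq.le, ← Real.rpow_mul (by positivity),
      one_div, inv_mul_cancel₀ hq.ne', Real.rpow_one, ENNReal.ofReal_coe_nnreal] at this
    rw [← this]
    gcongr with t
    split_ifs with h1 h2
    · exact le_rfl
    · exact absurd ENNReal.ofReal_lt_top h2
    · exact zero_le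
    · exact le_rfl
  · have := layer_fin q hq y.toReal ENNReal.toReal_nonneg
    rwa [ENNReal.ofReal_toReal hy] at this

lemma weak' {d : ℕ} (a : Idx d → ℝ≥0∞) (m μ ν : Measure (Fin d → ℝ)) (C : ℝ≥0∞)
    (h1 : ∀ i, a i * m (bal i) ≤ 1)
    (h : ∀ f : (Fin d → ℝ) → ℝ≥0∞, Measurable f →
      ∀ i, μ (bal5 i) * (a i * ∫⁻ y in bal i, f y ∂m) ≤ C * ∫⁻ y in bal i, f y ∂ν)
    (f : (Fin d → ℝ) → ℝ≥0∞) (hf : Measurable f) (t : ℝ≥0∞) :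
    t * μ {x | 2 * t < TT a m f x} ≤ C * ∫⁻ y, (if t < f y then f y else 0) ∂ν := by
  have hm : Measurable fun y => if t < f y then f y else 0 :=
    Measurable.ite (measurableSet_lt measurable_const hf) hf measurable_const
  refine le_trans ?_ (weak a m μ ν C _ (h _ hm) t)
  refine mul_le_mul_right (measure_mono ?_) t
  intro x hx
  simp only [Set.mem_ofPred_eq, lt_TT] at hx ⊢
  obtain ⟨i, hxi, hi⟩ := hx
  refine ⟨i, hxi, ?_⟩
  by_contra hcon
  rw [not_lt] at hcon
  refine absurd hi (not_lt.2 ?_)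
  calc a i * ∫⁻ y in bal i, f y ∂m
      ≤ a i * ∫⁻ y in bal i, ((if t < f y then f y else 0) + t) ∂m := by
        gcongr with y
        split_ifs with hy
        · exact le_self_add
        · simpa using hy
    _ = a i * ∫⁻ y in bal i, (if t < f y then f y else 0) ∂m + t * (a i * m (bal i)) := by
        rw [lintegral_add_left hm, mul_add, setLIntegral_const]
        ring
    _ ≤ t + t * 1 := by
        gcongr
        exact h1 i
    _ = 2 * t := by ring

lemma strong {d : ℕ} (a : Idx d → ℝ≥0∞) (m μ ν : Measure (Fin d → ℝ)) [SFinite μ] [SFinite ν]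
    (C : ℝ≥0∞) (q : ℝ) (hq : 1 < q)
    (h1 : ∀ i, a i * m (bal i) ≤ 1)
    (h : ∀ f : (Fin d → ℝ) → ℝ≥0∞, Measurable f →
      ∀ i, μ (bal5 i) * (a i * ∫⁻ y in bal i, f y ∂m) ≤ C * ∫⁻ y in bal i, f y ∂ν)
    (f : (Fin d → ℝ) → ℝ≥0∞) (hf : Measurable f) :
    ∫⁻ x, TT a m f x ^ q ∂μ ≤
      (ENNReal.ofReal q * (ENNReal.ofReal (q - 1))⁻¹ * 2 ^ q * C) * ∫⁻ x, f x ^ q ∂ν := by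
  have hq0 : 0 < q := by linarith
  have hq1 : 0 < q - 1 := by linarith
  have hT := meas_TT a m f
  have hpow : ∀ s : ℝ, Measurable fun t : ℝ => ENNReal.ofReal (t ^ s) := fun s => by fun_prop
  have key : ∀ t ∈ Set.Ioi (0:ℝ), μ {x | ENNReal.ofReal t < TT a m f x} * ENNReal.ofReal (t ^ (q-1))
      ≤ (2 * C) * ∫⁻ y, (if ENNReal.ofReal t < 2 * f y then f y * ENNReal.ofReal (t ^ (q-1-1)) else 0) ∂ν := by
    intro t ht
    have ht : 0 < t := ht
    have hw := weak' a m μ ν C h1 h f hf (ENNReal.ofReal (t/2))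
    have e2 : 2 * ENNReal.ofReal (t/2) = ENNReal.ofReal t := by
      rw [show (2:ℝ≥0∞) = ENNReal.ofReal 2 by simp, ← ENNReal.ofReal_mul (by norm_num)]
      congr 1; ring
    rw [e2] at hw
    have e3 : ENNReal.ofReal (t ^ (q-1)) = 2 * ENNReal.ofReal (t/2) * ENNReal.ofReal (t^(q-1-1)) := by
      rw [e2, ← ENNReal.ofReal_mul ht.le]
      congr 1
      rw [Real.rpow_sub_one ht.ne' (q-1)]
      field_simp
    have e4 : ∀ y, (ENNReal.ofReal t < 2 * f y) ↔ ENNReal.ofReal (t/2) < f y := by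
      intro y
      rw [← e2, ENNReal.mul_lt_mul_iff_right (by norm_num) (by norm_num)]
    calc μ {x | ENNReal.ofReal t < TT a m f x} * ENNReal.ofReal (t ^ (q-1))
        = (2 * ENNReal.ofReal (t^(q-1-1))) *
            (ENNReal.ofReal (t/2) * μ {x | ENNReal.ofReal t < TT a m f x}) := by
          rw [e3]; ring
      _ ≤ (2 * ENNReal.ofReal (t^(q-1-1))) *
          (C * ∫⁻ y, (if ENNReal.ofReal (t/2) < f y then f y else 0) ∂ν) := by gcongr
      _ = (2 * C) * ((∫⁻ y, (if ENNReal.ofReal (t/2) < f y then f y else 0) ∂ν) *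
            ENNReal.ofReal (t^(q-1-1))) := by ring
      _ = _ := by
          rw [← lintegral_mul_const' _ _ ENNReal.ofReal_ne_top]
          congr 2
          ext y
          simp only [e4, ite_mul, zero_mul]
  have hm1 : Measurable (Function.uncurry fun (x : Fin d → ℝ) (t : ℝ) =>
      if ENNReal.ofReal t < TT a m f x then ENNReal.ofReal (t ^ (q - 1)) else 0) := by
    refine Measurable.ite (measurableSet_lt ?_ ?_) ?_ measurable_const
    · exact ENNReal.measurable_ofReal.comp measurable_snd
    · exact hT.comp measurable_fst
    · exact (hpow _).comp measurable_snd
  have hm2 : Measurable (Function.uncurry fun (t : ℝ) (x : Fin d → ℝ) =>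
      if ENNReal.ofReal t < 2 * f x then f x * ENNReal.ofReal (t ^ (q - 1 - 1)) else 0) := by
    refine Measurable.ite (measurableSet_lt ?_ ?_) ?_ measurable_const
    · exact ENNReal.measurable_ofReal.comp measurable_fst
    · exact (hf.comp measurable_snd).const_mul 2
    · exact (hf.comp measurable_snd).mul ((hpow _).comp measurable_fst)
  have hinner : ∀ y, ∫⁻ t in Set.Ioi (0:ℝ),
      (if ENNReal.ofReal t < 2 * f y then f y * ENNReal.ofReal (t ^ (q-1-1)) else 0)
      ≤ (ENNReal.ofReal (q-1))⁻¹ * 2 ^ (q - 1) * f y ^ q := by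
    intro y
    have hl := layer (q-1) hq1 (2 * f y)
    have hne : ENNReal.ofReal (q-1) ≠ 0 := by simpa using hq1
    have : ∫⁻ t in Set.Ioi (0:ℝ),
      (if ENNReal.ofReal t < 2 * f y then f y * ENNReal.ofReal (t ^ (q-1-1)) else 0)
      = f y * ∫⁻ t in Set.Ioi (0:ℝ),
      (if ENNReal.ofReal t < 2 * f y then ENNReal.ofReal (t ^ (q-1-1)) else 0) := by
      rw [← lintegral_const_mul]
      · simp only [mul_ite, mul_zero]
      · exact Measurable.ite (measurableSet_lt ENNReal.measurable_ofReal measurable_const) (hpow _) measurable_const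
    rw [this]
    have e5 : ∫⁻ t in Set.Ioi (0:ℝ),
      (if ENNReal.ofReal t < 2 * f y then ENNReal.ofReal (t ^ (q-1-1)) else 0)
      = (ENNReal.ofReal (q-1))⁻¹ * (2 * f y) ^ (q-1) := by
      rw [← hl, ← mul_assoc, ENNReal.inv_mul_cancel hne ENNReal.ofReal_ne_top, one_mul]
    rw [e5, ENNReal.mul_rpow_of_nonneg _ _ hq1.le]
    have e6 : f y ^ q = f y * f y ^ (q-1) := by
      conv_lhs => rw [show q = 1 + (q-1) by ring]
      rw [ENNReal.rpow_add_of_nonneg _ _ (by norm_num) hq1.le, ENNReal.rpow_one]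
    rw [e6]
    apply le_of_eq; ring
  calc ∫⁻ x, TT a m f x ^ q ∂μ
      = ∫⁻ x, (ENNReal.ofReal q * ∫⁻ t in Set.Ioi (0:ℝ),
      (if ENNReal.ofReal t < TT a m f x then ENNReal.ofReal (t ^ (q - 1)) else 0)) ∂μ := by
        refine lintegral_congr fun x => ?_; rw [layer q hq0]
    _ = ENNReal.ofReal q * ∫⁻ x, (∫⁻ t in Set.Ioi (0:ℝ),
      (if ENNReal.ofReal t < TT a m f x then ENNReal.ofReal (t ^ (q - 1)) else 0)) ∂μ := by
        rw [lintegral_const_mul' _ _ ENNReal.ofReal_ne_top]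
    _ = ENNReal.ofReal q * ∫⁻ t in Set.Ioi (0:ℝ), ∫⁻ x,
      (if ENNReal.ofReal t < TT a m f x then ENNReal.ofReal (t ^ (q - 1)) else 0) ∂μ := by
        rw [lintegral_lintegral_swap hm1.aemeasurable]
    _ = ENNReal.ofReal q * ∫⁻ t in Set.Ioi (0:ℝ),
        μ {x | ENNReal.ofReal t < TT a m f x} * ENNReal.ofReal (t ^ (q-1)) := by
        congr 2; ext t
        have : MeasurableSet {x | ENNReal.ofReal t < TT a m f x} := measurableSet_lt measurable_const hT
        rw [mul_comm, ← lintegral_indicator_const this]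
        refine lintegral_congr fun x => ?_
        simp only [Set.indicator, Set.mem_ofPred_eq]
    _ ≤ ENNReal.ofReal q * ∫⁻ t in Set.Ioi (0:ℝ), (2 * C) *
        ∫⁻ y, (if ENNReal.ofReal t < 2 * f y then f y * ENNReal.ofReal (t ^ (q-1-1)) else 0) ∂ν := by
        refine mul_le_mul_right ?_ _
        exact setLIntegral_mono' measurableSet_Ioi key
    _ = ENNReal.ofReal q * ((2 * C) * ∫⁻ y, (∫⁻ t in Set.Ioi (0:ℝ),
        (if ENNReal.ofReal t < 2 * f y then f y * ENNReal.ofReal (t ^ (q-1-1)) else 0)) ∂ν) := by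
        rw [lintegral_const_mul _ (by exact Measurable.lintegral_prod_right' hm2),
          lintegral_lintegral_swap hm2.aemeasurable]
    _ ≤ ENNReal.ofReal q * ((2 * C) * ∫⁻ y,
        (ENNReal.ofReal (q-1))⁻¹ * 2 ^ (q - 1) * f y ^ q ∂ν) := by
        gcongr with y
        exact hinner y
    _ = _ := by
        rw [lintegral_const_mul _ (hf.pow_const q)]
        have : (2:ℝ≥0∞) ^ q = 2 * 2 ^ (q-1) := by
          conv_lhs => rw [show q = 1 + (q-1) by ring]
          rw [ENNReal.rpow_add_of_nonneg _ _ (by norm_num) hq1.le, ENNReal.rpow_one]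
        rw [this]
        ring

end FS


namespace FS

def i5 {d : ℕ} (i : Idx d) : Idx d := (i.1, ⟨5 * i.2.1, by have := i.2.2; positivity⟩)

lemma bal_i5 {d : ℕ} (i : Idx d) : bal (i5 i) = bal5 i := by
  unfold bal bal5 cen rad i5
  push_cast
  rfl

lemma bal_sub {d : ℕ} (i : Idx d) : bal i ⊆ bal5 i := by
  have := rad_pos i
  exact Metric.closedBall_subset_closedBall (by linarith)

lemma vol_ne_zero {d : ℕ} (i : Idx d) : volume (bal i) ≠ 0 := by
  have := rad_pos i
  unfold bal
  rw [Real.volume_pi_closedBall _ this.le]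
  simp only [ne_eq, ENNReal.ofReal_eq_zero, not_le]
  positivity

lemma vol_ne_top {d : ℕ} (i : Idx d) : volume (bal i) ≠ ∞ := by
  have := rad_pos i
  unfold bal
  rw [Real.volume_pi_closedBall _ this.le]
  exact ENNReal.ofReal_ne_top

lemma vol5 {d : ℕ} (i : Idx d) : volume (bal5 i) = 5 ^ d * volume (bal i) := by
  have := rad_pos i
  unfold bal bal5
  rw [Real.volume_pi_closedBall _ this.le, Real.volume_pi_closedBall _ (by positivity)]
  rw [show (5:ℝ≥0∞) ^ d = ENNReal.ofReal (5 ^ d) by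
    rw [ENNReal.ofReal_pow (by norm_num)]; simp, ← ENNReal.ofReal_mul (by positivity)]
  congr 1
  simp only [Fintype.card_fin, ← mul_pow]
  congr 1
  ring

noncomputable def MM {d : ℕ} (f : (Fin d → ℝ) → ℝ≥0∞) : (Fin d → ℝ) → ℝ≥0∞ :=
  TT (fun i => (volume (bal i))⁻¹) volume f

lemma meas_MM {d : ℕ} (f : (Fin d → ℝ) → ℝ≥0∞) : Measurable (MM f) := meas_TT _ _ _

noncomputable def KK (q : ℝ) (C : ℝ≥0∞) : ℝ≥0∞ :=
  ENNReal.ofReal q * (ENNReal.ofReal (q - 1))⁻¹ * 2 ^ q * C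

lemma KK_ne_top {q : ℝ} (hq : 1 < q) {C : ℝ≥0∞} (hC : C ≠ ∞) : KK q C ≠ ∞ := by
  unfold KK
  refine ENNReal.mul_ne_top (ENNReal.mul_ne_top (ENNReal.mul_ne_top ENNReal.ofReal_ne_top ?_) ?_) hC
  · simpa using hq
  · exact ENNReal.rpow_ne_top_of_nonneg (by linarith) (by norm_num)

/-- weighted Fefferman-Stein -/
lemma weighted {d : ℕ} (q : ℝ) (hq : 1 < q) (f w : (Fin d → ℝ) → ℝ≥0∞) (hf : Measurable f)
    (hw : Measurable w) :
    ∫⁻ x, MM f x ^ q * w x ≤ KK q (5 ^ d) * ∫⁻ x, f x ^ q * MM w x := by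
  have hmw := meas_MM w
  have := strong (fun i : Idx d => (volume (bal i))⁻¹) volume (volume.withDensity w)
    (volume.withDensity (MM w)) (5 ^ d) q hq
    (fun i => (ENNReal.inv_mul_cancel (vol_ne_zero i) (vol_ne_top i)).le) ?_ f hf
  · rw [lintegral_withDensity_eq_lintegral_mul _ hw ((meas_TT _ _ _).pow_const q),
      lintegral_withDensity_eq_lintegral_mul _ hmw (hf.pow_const q)] at this
    simp only [Pi.mul_apply] at this
    unfold KK
    simp_rw [mul_comm _ (w _), mul_comm _ (MM w _)]
    exact this
  · intro g hg i
    have hm5 : MeasurableSet (bal5 i) := by rw [← bal_i5]; exact meas_bal _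
    rw [withDensity_apply _ hm5, setLIntegral_withDensity_eq_setLIntegral_mul _ hmw hg (meas_bal i),
      ← lintegral_const_mul _ (hmw.mul hg), ← mul_assoc, ← lintegral_const_mul _ hg]
    refine setLIntegral_mono' (meas_bal i) fun x hx => ?_
    rw [Pi.mul_apply, ← mul_assoc]
    refine mul_le_mul_left ?_ _
    have h1 : x ∈ bal (i5 i) := by rw [bal_i5]; exact bal_sub i hx
    have h2 := le_TT (fun i : Idx d => (volume (bal i))⁻¹) volume w (i5 i) h1
    refine le_trans ?_ (mul_le_mul_right h2 _)
    simp only [bal_i5, vol5]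
    rw [ENNReal.mul_inv (Or.inl (by positivity)) (Or.inl (by simp)), ← mul_assoc, ← mul_assoc,
      ENNReal.mul_inv_cancel (by positivity) (by simp), one_mul, mul_comm]

lemma MM_one {d : ℕ} (x : Fin d → ℝ) : MM (fun _ => 1) x ≤ 1 := by
  refine TT_le fun i _ => ?_
  simp only [lintegral_const, one_mul, Measure.restrict_apply_univ]
  exact (ENNReal.inv_mul_cancel (vol_ne_zero i) (vol_ne_top i)).le

lemma scalar {d : ℕ} (q : ℝ) (hq : 1 < q) (f : (Fin d → ℝ) → ℝ≥0∞) (hf : Measurable f) :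
    ∫⁻ x, MM f x ^ q ≤ KK q (5 ^ d) * ∫⁻ x, f x ^ q := by
  have := weighted q hq f (fun _ => 1) hf measurable_const
  simp only [mul_one] at this
  refine this.trans ?_
  gcongr with x
  exact mul_le_of_le_one_right' (MM_one x)

lemma MM_mono {d : ℕ} {f g : (Fin d → ℝ) → ℝ≥0∞} (h : ∀ x, f x ≤ g x) (x) : MM f x ≤ MM g x := by
  refine TT_le fun i hi => le_trans ?_ (le_TT _ _ _ i hi)
  gcongr with y
  exact h y

lemma MM_tsum {d : ℕ} (f : ℕ → (Fin d → ℝ) → ℝ≥0∞) (hf : ∀ j, Measurable (f j)) (x) :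
    MM (fun x => ∑' j, f j x) x ≤ ∑' j, MM (f j) x := by
  refine TT_le fun i hi => ?_
  rw [lintegral_tsum (fun j => (hf j).aemeasurable), ← ENNReal.tsum_mul_left]
  exact ENNReal.tsum_le_tsum fun j => le_TT _ _ _ i hi

lemma MM_const_mul {d : ℕ} (c : ℝ≥0∞) (f : (Fin d → ℝ) → ℝ≥0∞) (hf : Measurable f) (x) :
    MM (fun x => c * f x) x ≤ c * MM f x := by
  refine TT_le fun i hi => ?_
  rw [lintegral_const_mul _ hf, mul_left_comm]
  gcongr
  exact le_TT _ _ _ i hi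

/-- Rubio de Francia iteration. -/
lemma rdf (d : ℕ) (s : ℝ) (hs : 1 < s) : ∃ K : ℝ≥0∞, K ≠ ∞ ∧
    ∀ g : (Fin d → ℝ) → ℝ≥0∞, Measurable g → ∃ v : (Fin d → ℝ) → ℝ≥0∞, Measurable v ∧
      (∀ x, g x ≤ v x) ∧ (∀ x, MM v x ≤ K * v x) ∧ ∫⁻ x, v x ^ s ≤ (2 ^ s * 2) * ∫⁻ x, g x ^ s := by
  have hs0 : 0 < s := by linarith
  set A : ℝ≥0∞ := KK s (5 ^ d) with hA
  have hAt : A ≠ ∞ := KK_ne_top hs (by simp)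
  have hA0 : A ≠ 0 := by
    rw [hA]; unfold KK
    have h1 : ENNReal.ofReal s ≠ 0 := by simpa using hs0
    have h3 : (2:ℝ≥0∞) ^ s ≠ 0 := (ENNReal.rpow_pos (by norm_num) (by norm_num)).ne'
    simp [h1, h3]
  set c : ℝ≥0∞ := (2 * A) ^ (-(1 / s)) with hc
  have h2A0 : 2 * A ≠ 0 := by simp [hA0]
  have h2At : 2 * A ≠ ∞ := ENNReal.mul_ne_top (by norm_num) hAt
  have hct : c ≠ ∞ := ENNReal.rpow_ne_top_of_ne_zero h2A0 h2At
  have hc0 : c ≠ 0 := (ENNReal.rpow_pos (pos_iff_ne_zero.2 h2A0) h2At).ne'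
  have hcs : c ^ s * A = 2⁻¹ := by
    rw [hc, ← ENNReal.rpow_mul, show -(1/s) * s = -1 by field_simp, ENNReal.rpow_neg_one,
      ENNReal.mul_inv (by simp) (by simp), mul_assoc, ENNReal.inv_mul_cancel hA0 hAt, mul_one]
  refine ⟨2 * c⁻¹, ENNReal.mul_ne_top (by norm_num) (by simpa using hc0), fun g hg => ?_⟩
  let G : ℕ → (Fin d → ℝ) → ℝ≥0∞ := fun j => MM^[j] g
  have hG : ∀ j, Measurable (G j) := by
    intro j
    cases j with
    | zero => exact hg
    | succ j =>
      simp only [G, Function.iterate_succ', Function.comp]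
      exact meas_MM _
  have hGs : ∀ j, MM (G j) = G (j+1) := fun j => by
    simp only [G, Function.iterate_succ', Function.comp]
  have hGi : ∀ j, ∫⁻ x, G j x ^ s ≤ A ^ j * ∫⁻ x, g x ^ s := by
    intro j
    induction j with
    | zero => simp [G]
    | succ j ih =>
      rw [← hGs]
      refine (scalar s hs (G j) (hG j)).trans ?_
      rw [pow_succ', mul_assoc]
      gcongr
  have hsum2 : ∑' j : ℕ, (2⁻¹ : ℝ≥0∞) ^ j = 2 := by
    rw [ENNReal.tsum_geometric, ENNReal.one_sub_inv_two, inv_inv]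
  refine ⟨fun x => ∑' j, (2⁻¹ * c) ^ j * G j x, ?_, ?_, ?_, ?_⟩
  · exact Measurable.tsum fun j => (hG j).const_mul _
  · intro x
    refine le_trans (le_of_eq ?_) (ENNReal.le_tsum 0)
    simp [G]
  · intro x
    refine (MM_tsum _ (fun j => (hG j).const_mul _) x).trans ?_
    calc ∑' j, MM (fun x => (2⁻¹ * c) ^ j * G j x) x
        ≤ ∑' j, (2 * c⁻¹) * ((2⁻¹ * c) ^ (j+1) * G (j+1) x) := by
          refine ENNReal.tsum_le_tsum fun j => ?_
          refine (MM_const_mul _ _ (hG j) x).trans (le_of_eq ?_)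
          rw [hGs, pow_succ, ← mul_assoc, mul_comm (2 * c⁻¹), mul_assoc ((2⁻¹ * c) ^ j)]
          have : 2⁻¹ * c * (2 * c⁻¹) = 1 := by
            rw [mul_mul_mul_comm, ENNReal.inv_mul_cancel (by norm_num) (by norm_num),
              ENNReal.mul_inv_cancel hc0 hct, one_mul]
          rw [this, mul_one]
      _ = (2 * c⁻¹) * ∑' j, ((2⁻¹ * c) ^ (j+1) * G (j+1) x) := ENNReal.tsum_mul_left
      _ ≤ (2 * c⁻¹) * ∑' j, ((2⁻¹ * c) ^ j * G j x) := by
          refine mul_le_mul_right ?_ _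
          exact ENNReal.tsum_comp_le_tsum_of_injective (add_left_injective 1)
            (fun j => (2⁻¹ * c) ^ j * G j x)
  · have hpt : ∀ x, (∑' j, (2⁻¹ * c) ^ j * G j x) ^ s ≤ 2 ^ s * ∑' j, (c ^ j * G j x) ^ s := by
      intro x
      have h1 : ∑' j, (2⁻¹ * c) ^ j * G j x ≤ 2 * ⨆ j, c ^ j * G j x := by
        refine le_trans ?_ (mul_le_mul_left hsum2.le _)
        rw [← ENNReal.tsum_mul_right]
        refine ENNReal.tsum_le_tsum fun j => ?_
        rw [mul_pow, mul_assoc]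
        gcongr
        exact le_iSup (fun j => c ^ j * G j x) j
      refine (ENNReal.rpow_le_rpow h1 hs0.le).trans ?_
      rw [ENNReal.mul_rpow_of_nonneg _ _ hs0.le]
      gcongr
      have := (ENNReal.orderIsoRpow s hs0).map_iSup (fun j => c ^ j * G j x)
      simp only [ENNReal.orderIsoRpow_apply] at this
      rw [this]
      exact iSup_le fun j => ENNReal.le_tsum j
    calc ∫⁻ x, (∑' j, (2⁻¹ * c) ^ j * G j x) ^ s ≤ ∫⁻ x, 2 ^ s * ∑' j, (c ^ j * G j x) ^ s :=
          lintegral_mono hpt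
      _ = 2 ^ s * ∑' j, ∫⁻ x, (c ^ j * G j x) ^ s := by
          rw [lintegral_const_mul, lintegral_tsum]
          · exact fun j => (((hG j).const_mul _).pow_const s).aemeasurable
          · exact Measurable.tsum fun j => (((hG j).const_mul _).pow_const s)
      _ ≤ 2 ^ s * ∑' j : ℕ, 2⁻¹ ^ j * ∫⁻ x, g x ^ s := by
          gcongr with j
          calc ∫⁻ x, (c ^ j * G j x) ^ s = (c ^ s) ^ j * ∫⁻ x, G j x ^ s := by
                simp_rw [ENNReal.mul_rpow_of_nonneg _ _ hs0.le]
                rw [lintegral_const_mul _ ((hG j).pow_const s)]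
                congr 1
                rw [← ENNReal.rpow_natCast, ← ENNReal.rpow_natCast, ← ENNReal.rpow_mul c,
                  ← ENNReal.rpow_mul c, mul_comm s]
            _ ≤ (c ^ s) ^ j * (A ^ j * ∫⁻ x, g x ^ s) := by gcongr; exact hGi j
            _ = _ := by rw [← mul_assoc, ← mul_pow, hcs]
      _ = _ := by rw [ENNReal.tsum_mul_right, hsum2, mul_assoc]

/-- maximal operator w.r.t. weight -/
noncomputable def NN {d : ℕ} (v f : (Fin d → ℝ) → ℝ≥0∞) : (Fin d → ℝ) → ℝ≥0∞ :=
  TT (fun i => (∫⁻ y in bal i, v y)⁻¹) (volume.withDensity v) f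

lemma a1_avg {d : ℕ} {v : (Fin d → ℝ) → ℝ≥0∞} {K : ℝ≥0∞} (hK : ∀ x, MM v x ≤ K * v x)
    (i : Idx d) {x : Fin d → ℝ} (hx : x ∈ bal i) :
    ∫⁻ y in bal i, v y ≤ volume (bal i) * (K * v x) := by
  have h2 := (le_TT (fun i : Idx d => (volume (bal i))⁻¹) volume v i hx).trans (hK x)
  rwa [mul_comm, ← div_eq_mul_inv, ENNReal.div_le_iff (vol_ne_zero i) (vol_ne_top i), mul_comm] at h2

lemma a1_doubling {d : ℕ} {v : (Fin d → ℝ) → ℝ≥0∞} (hv : Measurable v)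
    {K : ℝ≥0∞} (hK : ∀ x, MM v x ≤ K * v x) (i : Idx d) :
    ∫⁻ y in bal5 i, v y ≤ 5 ^ d * K * ∫⁻ y in bal i, v y := by
  have h : ∀ x ∈ bal i, (volume (bal i))⁻¹ * ∫⁻ y in bal5 i, v y ≤ 5 ^ d * K * v x := by
    intro x hx
    have h1 := a1_avg hK (i5 i) (x := x) (by rw [bal_i5]; exact bal_sub i hx)
    rw [bal_i5, vol5] at h1
    refine (mul_le_mul_right h1 _).trans (le_of_eq ?_)
    calc _ = ((volume (bal i))⁻¹ * volume (bal i)) * (5 ^ d * K * v x) := by ring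
      _ = _ := by rw [ENNReal.inv_mul_cancel (vol_ne_zero i) (vol_ne_top i), one_mul]
  have h3 := setLIntegral_mono' (μ := volume) (meas_bal i) h
  rw [setLIntegral_const, lintegral_const_mul _ hv] at h3
  refine le_trans (le_of_eq ?_) h3
  rw [mul_right_comm, ENNReal.inv_mul_cancel (vol_ne_zero i) (vol_ne_top i), one_mul]

lemma strongNN {d : ℕ} (q : ℝ) (hq : 1 < q) (v f : (Fin d → ℝ) → ℝ≥0∞) (hv : Measurable v)
    (hf : Measurable f) {K : ℝ≥0∞} (hK : ∀ x, MM v x ≤ K * v x) :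
    ∫⁻ x, NN v f x ^ q * v x ≤ KK q (5 ^ d * K) * ∫⁻ x, f x ^ q * v x := by
  have := strong (fun i : Idx d => (∫⁻ y in bal i, v y)⁻¹) (volume.withDensity v)
    (volume.withDensity v)
    (volume.withDensity v) (5 ^ d * K) q hq ?_ ?_ f hf
  · rw [lintegral_withDensity_eq_lintegral_mul _ hv ((meas_TT _ _ _).pow_const q),
      lintegral_withDensity_eq_lintegral_mul _ hv (hf.pow_const q)] at this
    simp only [Pi.mul_apply] at this
    unfold KK
    simp_rw [mul_comm _ (v _)]
    exact this
  · intro i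
    rw [withDensity_apply _ (meas_bal i)]
    exact ENNReal.inv_mul_le_one _
  · intro g hg i
    have hm5 : MeasurableSet (bal5 i) := by rw [← bal_i5]; exact meas_bal _
    by_cases h0 : ∫⁻ y in bal i, v y = 0
    · have : ∫⁻ y in bal i, g y ∂volume.withDensity v = 0 := by
        rw [Measure.restrict_eq_zero.2 (by rw [withDensity_apply _ (meas_bal i), h0])]
        simp
      rw [this]; simp
    by_cases ht : ∫⁻ y in bal i, v y = ∞
    · simp [ht]
    rw [withDensity_apply _ hm5, ← mul_assoc]
    refine mul_le_mul_left ?_ _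
    rw [← div_eq_mul_inv, ENNReal.div_le_iff h0 ht]
    exact a1_doubling hv hK i

lemma MM_le_NN {d : ℕ} (v f : (Fin d → ℝ) → ℝ≥0∞) (hv : Measurable v)
    (hf : Measurable f) {K : ℝ≥0∞} (hKt : K ≠ ∞) (hK : ∀ x, MM v x ≤ K * v x)
    (hfv : ∀ x, v x = 0 → f x = 0) (hfin : ∀ᵐ x, v x ≠ ∞) (x : Fin d → ℝ) (hx : v x ≠ ∞) :
    MM f x ≤ K * v x * NN v (fun y => f y / v y) x := by
  refine TT_le fun i hi => ?_
  have hd : Measurable fun y => f y / v y := hf.div hv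
  have e : ∫⁻ y in bal i, f y = ∫⁻ y in bal i, f y / v y ∂volume.withDensity v := by
    rw [setLIntegral_withDensity_eq_setLIntegral_mul _ hv hd (meas_bal i)]
    refine lintegral_congr_ae (ae_restrict_of_ae ?_)
    filter_upwards [hfin] with y hy
    rw [Pi.mul_apply]
    by_cases h0 : v y = 0
    · simp [h0, hfv y h0]
    · rw [mul_comm, ENNReal.div_mul_cancel h0 hy]
  have h1 := a1_avg hK i hi
  have hvt : ∫⁻ y in bal i, v y ≠ ∞ :=
    ne_top_of_le_ne_top (ENNReal.mul_ne_top (vol_ne_top i) (ENNReal.mul_ne_top hKt hx)) h1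
  have h2 := le_TT (fun i : Idx d => (∫⁻ y in bal i, v y)⁻¹) (volume.withDensity v)
    (fun y => f y / v y) i hi
  rw [e]
  by_cases h0 : ∫⁻ y in bal i, v y = 0
  · have : ∫⁻ y in bal i, f y / v y ∂volume.withDensity v = 0 := by
      rw [Measure.restrict_eq_zero.2 (by rw [withDensity_apply _ (meas_bal i), h0])]
      simp
    rw [this]; simp
  refine le_trans ?_ (mul_le_mul_right h2 _)
  rw [← mul_assoc]
  gcongr
  rw [← div_eq_mul_inv, ENNReal.le_div_iff_mul_le (Or.inl h0) (Or.inl hvt), mul_comm,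
    ← div_eq_mul_inv, ENNReal.div_le_iff (vol_ne_zero i) (vol_ne_top i), mul_comm]
  exact h1

end FS


namespace FS

lemma rpow_split (y : ℝ≥0∞) {a b c : ℝ} (ha : 0 ≤ a) (hb : 0 ≤ b) (h : a + b = c) :
    y ^ c = y ^ a * y ^ b := by
  rw [← h, ENNReal.rpow_add_of_nonneg _ _ ha hb]

lemma case_eq {J : Type*} [Countable J] (d : ℕ) (q : ℝ) (hq : 1 < q) :
    ∃ C : ℝ≥0∞, C ≠ ∞ ∧ ∀ f : J → (Fin d → ℝ) → ℝ≥0∞, (∀ k, Measurable (f k)) →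
      ∫⁻ x, (∑' k, MM (f k) x ^ q) ≤ C * ∫⁻ x, (∑' k, f k x ^ q) := by
  refine ⟨KK q (5 ^ d), KK_ne_top hq (by simp), fun f hf => ?_⟩
  rw [lintegral_tsum (fun k => ((meas_MM (f k)).pow_const q).aemeasurable),
    lintegral_tsum (fun k => ((hf k).pow_const q).aemeasurable), ← ENNReal.tsum_mul_left]
  exact ENNReal.tsum_le_tsum fun k => scalar q hq (f k) (hf k)

lemma ptwise (p q : ℝ) (hp : 1 < p) (hpq : p < q) (Φ v : ℝ≥0∞) (hv : v ≠ ∞)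
    (h : Φ ^ ((q - p) / (q - 1) / q) ≤ v) : Φ * (v⁻¹ ^ q * v) ≤ Φ ^ (p / q) := by
  have hq0 : 0 < q := by linarith
  have hq1 : 0 < q - 1 := by linarith
  have hqp : 0 < q - p := by linarith
  have hθ : 0 < (q - p) / (q - 1) / q := by positivity
  by_cases h0 : Φ = 0
  · simp [h0]
  by_cases hΦt : Φ = ∞
  · subst hΦt
    rw [ENNReal.top_rpow_of_pos hθ, top_le_iff] at h
    exact absurd h hv
  have hpos : Φ ^ ((q - p) / (q - 1) / q) ≠ 0 := (ENNReal.rpow_pos (pos_iff_ne_zero.2 h0) hΦt).ne'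
  have hv0 : v ≠ 0 := fun hh => hpos (by simpa [hh] using h)
  have e1 : v⁻¹ ^ q * v = v⁻¹ ^ (q - 1) := by
    rw [rpow_split v⁻¹ hq1.le zero_le_one (by ring : q - 1 + 1 = q), ENNReal.rpow_one, mul_assoc,
      ENNReal.inv_mul_cancel hv0 hv, mul_one]
  rw [e1]
  calc Φ * v⁻¹ ^ (q-1) ≤ Φ * (Φ ^ ((q - p) / (q - 1) / q))⁻¹ ^ (q-1) := by
        gcongr
    _ = Φ ^ (1:ℝ) * Φ ^ (-((q-p)/q)) := by
        rw [← ENNReal.rpow_neg, ← ENNReal.rpow_mul, ENNReal.rpow_one]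
        congr 2
        field_simp
    _ = Φ ^ (p/q) := by
        rw [← ENNReal.rpow_add _ _ h0 hΦt]
        congr 1
        field_simp
        ring

lemma case_lt {J : Type*} [Countable J] (d : ℕ) (p q : ℝ) (hp : 1 < p) (hpq : p < q) :
    ∃ C : ℝ≥0∞, C ≠ ∞ ∧ ∀ f : J → (Fin d → ℝ) → ℝ≥0∞, (∀ k, Measurable (f k)) →
      ∫⁻ x, (∑' k, MM (f k) x ^ q) ^ (p / q) ≤ C * ∫⁻ x, (∑' k, f k x ^ q) ^ (p / q) := by
  have hp0 : 0 < p := by linarith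
  have hq0 : 0 < q := by linarith
  have hq : 1 < q := by linarith
  have hq1 : 0 < q - 1 := by linarith
  have hqp : 0 < q - p := by linarith
  set θ : ℝ := (q - p) / (q - 1) with hθd
  have hθ : 0 < θ := by positivity
  set s : ℝ := p / θ with hsd
  have hs : 1 < s := by
    rw [hsd, lt_div_iff₀ hθ, hθd, one_mul, div_lt_iff₀ hq1]
    nlinarith
  have hs0 : 0 < s := by linarith
  obtain ⟨K, hKt, hrdf⟩ := rdf d s hs
  set C1 := KK q (5 ^ d * K) with hC1
  have hC1t : C1 ≠ ∞ := KK_ne_top hq (ENNReal.mul_ne_top (by simp) hKt)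
  have hb0 : 0 ≤ 1 - p / q := by
    rw [sub_nonneg, div_le_one hq0]; exact hpq.le
  have ha0 : 0 ≤ p / q := by positivity
  set C := K ^ p * (C1 ^ (p/q) * (2 ^ s * 2) ^ (1 - p/q)) + 1 with hC
  have hCt : C ≠ ∞ := by
    refine ENNReal.add_ne_top.2 ⟨?_, by simp⟩
    refine ENNReal.mul_ne_top (ENNReal.rpow_ne_top_of_nonneg hp0.le hKt) (ENNReal.mul_ne_top
      (ENNReal.rpow_ne_top_of_nonneg ha0 hC1t) (ENNReal.rpow_ne_top_of_nonneg hb0 ?_))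
    exact ENNReal.mul_ne_top (ENNReal.rpow_ne_top_of_nonneg hs0.le (by simp)) (by simp)
  refine ⟨C, hCt, fun f hf => ?_⟩
  set Φ : (Fin d → ℝ) → ℝ≥0∞ := fun x => ∑' k, f k x ^ q with hΦ
  have hΦm : Measurable Φ := Measurable.tsum fun k => (hf k).pow_const q
  set I := ∫⁻ x, Φ x ^ (p / q) with hI
  change _ ≤ C * I
  by_cases hIt : I = ∞
  · rw [hIt, ENNReal.mul_top (by simp [hC])]
    exact le_top
  obtain ⟨v, hvm, hgv, hMv, hvs⟩ := hrdf (fun x => Φ x ^ (θ / q)) (hΦm.pow_const _)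
  have e1 : ∫⁻ x, (Φ x ^ (θ / q)) ^ s = I := by
    refine lintegral_congr fun x => ?_
    rw [← ENNReal.rpow_mul]
    congr 1
    rw [hsd]
    field_simp
  rw [e1] at hvs
  have hvst : ∫⁻ x, v x ^ s ≠ ∞ := ne_top_of_le_ne_top (ENNReal.mul_ne_top (ENNReal.mul_ne_top
    (ENNReal.rpow_ne_top_of_nonneg hs0.le (by simp)) (by simp)) hIt) hvs
  have hvfin : ∀ᵐ x, v x ≠ ∞ := by
    filter_upwards [ae_lt_top (hvm.pow_const s) hvst] with x hx hx2
    simp [hx2, ENNReal.top_rpow_of_pos hs0] at hx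
  have hfv : ∀ k x, v x = 0 → f k x = 0 := by
    intro k x hx
    have h1 := hgv x
    rw [hx, nonpos_iff_eq_zero, ENNReal.rpow_eq_zero_iff_of_pos (by positivity)] at h1
    have h2 := (ENNReal.tsum_eq_zero.1 h1) k
    rwa [ENNReal.rpow_eq_zero_iff_of_pos hq0] at h2
  set Ψ : (Fin d → ℝ) → ℝ≥0∞ := fun x => ∑' k, NN v (fun y => f k y / v y) x ^ q with hΨ
  have hNm : ∀ k, Measurable (NN v (fun y => f k y / v y)) := fun k => meas_TT _ _ _
  have hΨm : Measurable Ψ := Measurable.tsum fun k => (hNm k).pow_const q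
  have hΨv : ∫⁻ x, Ψ x * v x ≤ C1 * I := by
    calc ∫⁻ x, Ψ x * v x = ∫⁻ x, ∑' k, NN v (fun y => f k y / v y) x ^ q * v x := by
          simp_rw [hΨ, ENNReal.tsum_mul_right]
      _ = ∑' k, ∫⁻ x, NN v (fun y => f k y / v y) x ^ q * v x :=
          lintegral_tsum fun k => (((hNm k).pow_const q).mul hvm).aemeasurable
      _ ≤ ∑' k, C1 * ∫⁻ x, (f k x / v x) ^ q * v x :=
          ENNReal.tsum_le_tsum fun k => strongNN q hq v _ hvm ((hf k).div hvm) hMv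
      _ = C1 * ∫⁻ x, ∑' k, (f k x / v x) ^ q * v x := by
          rw [ENNReal.tsum_mul_left, lintegral_tsum]
          exact fun k => ((((hf k).div hvm).pow_const q).mul hvm).aemeasurable
      _ ≤ C1 * I := by
          refine mul_le_mul_right (lintegral_mono_ae ?_) _
          filter_upwards [hvfin] with x hx
          simp_rw [div_eq_mul_inv, ENNReal.mul_rpow_of_nonneg _ _ hq0.le, mul_assoc]
          rw [ENNReal.tsum_mul_right]
          exact ptwise p q hp hpq (Φ x) (v x) hx (hgv x)
  calc ∫⁻ x, (∑' k, MM (f k) x ^ q) ^ (p / q)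
      ≤ ∫⁻ x, K ^ p * ((Ψ x * v x) ^ (p/q) * (v x ^ s) ^ (1 - p/q)) := by
        refine lintegral_mono_ae ?_
        filter_upwards [hvfin] with x hx
        have h1 : ∑' k, MM (f k) x ^ q ≤ (K * v x) ^ q * Ψ x := by
          rw [hΨ, ← ENNReal.tsum_mul_left]
          refine ENNReal.tsum_le_tsum fun k => ?_
          rw [← ENNReal.mul_rpow_of_nonneg _ _ hq0.le]
          exact ENNReal.rpow_le_rpow (MM_le_NN v (f k) hvm (hf k) hKt hMv (hfv k) hvfin x hx) hq0.le
        refine (ENNReal.rpow_le_rpow h1 ha0).trans (le_of_eq ?_)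
        rw [ENNReal.mul_rpow_of_nonneg _ _ ha0, ENNReal.mul_rpow_of_nonneg _ _ ha0,
          ← ENNReal.rpow_mul, ← ENNReal.rpow_mul, show q * (p/q) = p by field_simp,
          ENNReal.mul_rpow_of_nonneg _ _ hp0.le,
          rpow_split (v x) (a := p/q) (b := s * (1 - p/q)) (c := p) ha0 (by positivity) ?_]
        · ring
        · rw [hsd, hθd]; field_simp; ring
    _ = K ^ p * ∫⁻ x, ((Ψ x * v x) ^ (p/q) * (v x ^ s) ^ (1 - p/q)) :=
        lintegral_const_mul' _ _ (ENNReal.rpow_ne_top_of_nonneg hp0.le hKt)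
    _ ≤ K ^ p * ((∫⁻ x, Ψ x * v x) ^ (p/q) * (∫⁻ x, v x ^ s) ^ (1 - p/q)) := by
        gcongr
        exact ENNReal.lintegral_mul_norm_pow_le (hΨm.mul hvm).aemeasurable
          (hvm.pow_const s).aemeasurable ha0 hb0 (by ring)
    _ ≤ K ^ p * ((C1 * I) ^ (p/q) * ((2 ^ s * 2) * I) ^ (1 - p/q)) := by
        gcongr
    _ = (K ^ p * (C1 ^ (p/q) * (2 ^ s * 2) ^ (1 - p/q))) * I := by
        rw [ENNReal.mul_rpow_of_nonneg _ _ ha0, ENNReal.mul_rpow_of_nonneg _ _ hb0]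
        have : I = I ^ (p/q) * I ^ (1 - p/q) := by
          rw [← rpow_split I ha0 hb0 (by ring : p/q + (1 - p/q) = 1), ENNReal.rpow_one]
        conv_rhs => rw [this]
        ring
    _ ≤ C * I := by
        gcongr
        exact le_self_add

lemma absorb (I G B : ℝ≥0∞) (a : ℝ) (ha : 0 < a) (hI : I ≠ ∞)
    (h : I ≤ B * (G ^ a * I ^ (1 - a))) : I ≤ B ^ (1 / a) * G := by
  by_cases h0 : I = 0
  · simp [h0]
  have h1 : I ^ a ≤ B * G ^ a := by
    calc I ^ a = I * I ^ (-(1-a)) := by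
          rw [show a = 1 + -(1-a) by ring, ENNReal.rpow_add _ _ h0 hI, ENNReal.rpow_one]; ring_nf
      _ ≤ B * (G ^ a * I ^ (1 - a)) * I ^ (-(1-a)) := by gcongr
      _ = B * G ^ a * (I ^ (1 - a) * I ^ (-(1-a))) := by ring
      _ = B * G ^ a := by rw [← ENNReal.rpow_add _ _ h0 hI]; simp
  have h2 := ENNReal.rpow_le_rpow h1 (by positivity : 0 ≤ 1 / a)
  rwa [← ENNReal.rpow_mul, ENNReal.mul_rpow_of_nonneg _ _ (by positivity), ← ENNReal.rpow_mul,
    mul_one_div_cancel ha.ne', ENNReal.rpow_one, ENNReal.rpow_one] at h2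

lemma case_gt {J : Type*} [Countable J] (d : ℕ) (p q : ℝ) (hq : 1 < q) (hpq : q < p) :
    ∃ C : ℝ≥0∞, C ≠ ∞ ∧ ∀ f : J → (Fin d → ℝ) → ℝ≥0∞, (∀ k, Measurable (f k)) →
      ∫⁻ x, (∑' k, MM (f k) x ^ q) ^ (p / q) ≤ C * ∫⁻ x, (∑' k, f k x ^ q) ^ (p / q) := by
  have hp0 : 0 < p := by linarith
  have hq0 : 0 < q := by linarith
  have hqp : 0 < p - q := by linarith
  set r : ℝ := p / (p - q) with hrd
  have hr : 1 < r := by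
    rw [hrd, lt_div_iff₀ hqp]; linarith
  set A := KK q (5 ^ d) with hA
  set Ar := KK r (5 ^ d) with hAr
  have hAt : A ≠ ∞ := KK_ne_top hq (by simp)
  have hArt : Ar ≠ ∞ := KK_ne_top hr (by simp)
  have ha : 0 < q / p := by positivity
  have hb : 0 ≤ 1 - q / p := by
    rw [sub_nonneg, div_le_one hp0]; exact hpq.le
  have hb' : 0 < p / q - 1 := by
    rw [sub_pos, lt_div_iff₀ hq0]; linarith
  have hpq0 : 0 < p / q := by positivity
  refine ⟨(A * Ar ^ (1 - q/p)) ^ (1 / (q/p)), ?_, fun f hf => ?_⟩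
  · exact ENNReal.rpow_ne_top_of_nonneg (by positivity)
      (ENNReal.mul_ne_top hAt (ENNReal.rpow_ne_top_of_nonneg hb hArt))
  set Φ : (Fin d → ℝ) → ℝ≥0∞ := fun x => ∑' k, f k x ^ q with hΦ
  have hΦm : Measurable Φ := Measurable.tsum fun k => (hf k).pow_const q
  set Θ : (Fin d → ℝ) → ℝ≥0∞ := fun x => ∑' k, MM (f k) x ^ q with hΘ
  have hΘm : Measurable Θ := Measurable.tsum fun k => (meas_MM (f k)).pow_const q
  let Θn : ℕ → (Fin d → ℝ) → ℝ≥0∞ := fun n =>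
    (Metric.closedBall 0 (n:ℝ)).indicator (fun x => min (Θ x) n)
  have hΘnm : ∀ n, Measurable (Θn n) := fun n =>
    (hΘm.min measurable_const).indicator Metric.isClosed_closedBall.measurableSet
  have hle : ∀ n x, Θn n x ≤ Θ x := by
    intro n x
    refine (Set.indicator_le_self _ _ x).trans (min_le_left _ _)
  have hmono : Monotone Θn := by
    intro n k hnk x
    simp only [Θn]
    refine (Set.indicator_le_indicator (g := fun x => min (Θ x) (k:ℝ≥0∞)) ?_).trans
      (Set.indicator_le_indicator_of_subset
      (Metric.closedBall_subset_closedBall (by exact_mod_cast hnk)) (fun _ => zero_le) x)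
    gcongr
  have hsup : ∀ x, ⨆ n, Θn n x ^ (p/q) = Θ x ^ (p/q) := by
    intro x
    refine le_antisymm (iSup_le fun n => ENNReal.rpow_le_rpow (hle n x) hpq0.le) ?_
    have e := (ENNReal.orderIsoRpow (p/q) hpq0).map_iSup (fun n => Θn n x)
    simp only [ENNReal.orderIsoRpow_apply] at e
    rw [← e]
    refine ENNReal.rpow_le_rpow ?_ hpq0.le
    refine le_of_forall_lt fun t ht => ?_
    obtain ⟨n1, hn1⟩ := exists_nat_ge ‖x‖
    obtain ⟨n2, hn2⟩ := ENNReal.exists_nat_gt ht.ne_top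
    refine lt_of_lt_of_le ?_ (le_iSup (fun n => Θn n x) (max n1 n2))
    have hx : x ∈ Metric.closedBall (0 : Fin d → ℝ) ((max n1 n2 : ℕ) : ℝ) := by
      rw [mem_closedBall_zero_iff]
      exact hn1.trans (by exact_mod_cast le_max_left _ _)
    simp only [Θn, Set.indicator_of_mem hx]
    refine lt_min ht (hn2.trans_le ?_)
    exact_mod_cast le_max_right _ _
  have hfin : ∀ n, ∫⁻ x, Θn n x ^ (p/q) ≠ ∞ := by
    intro n
    have h1 : ∀ x, Θn n x ^ (p/q) ≤
        (Metric.closedBall (0 : Fin d → ℝ) (n:ℝ)).indicator (fun _ => (n:ℝ≥0∞) ^ (p/q)) x := by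
      intro x
      by_cases hx : x ∈ Metric.closedBall (0 : Fin d → ℝ) (n:ℝ)
      · simp only [Θn, Set.indicator_of_mem hx]
        exact ENNReal.rpow_le_rpow (min_le_right _ _) hpq0.le
      · simp only [Θn, Set.indicator_of_notMem hx]
        simp [hpq0]
    refine ne_top_of_le_ne_top ?_ (lintegral_mono h1)
    rw [lintegral_indicator_const Metric.isClosed_closedBall.measurableSet]
    exact ENNReal.mul_ne_top (ENNReal.rpow_ne_top_of_nonneg hpq0.le (by simp))
      measure_closedBall_lt_top.ne
  have main : ∀ n, ∫⁻ x, Θn n x ^ (p/q) ≤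
      (A * Ar ^ (1 - q/p)) ^ (1 / (q/p)) * ∫⁻ x, Φ x ^ (p/q) := by
    intro n
    refine absorb _ _ _ _ ha (hfin n) ?_
    set h : (Fin d → ℝ) → ℝ≥0∞ := fun x => Θn n x ^ (p/q - 1) with hh
    have hhm : Measurable h := (hΘnm n).pow_const _
    calc ∫⁻ x, Θn n x ^ (p/q) ≤ ∫⁻ x, Θ x * h x := by
          refine lintegral_mono fun x => ?_
          rw [rpow_split _ zero_le_one hb'.le (by ring : 1 + (p/q - 1) = p/q), ENNReal.rpow_one]
          exact mul_le_mul_left (hle n x) _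
      _ = ∑' k, ∫⁻ x, MM (f k) x ^ q * h x := by
          simp_rw [hΘ, ← ENNReal.tsum_mul_right]
          exact lintegral_tsum fun k => (((meas_MM (f k)).pow_const q).mul hhm).aemeasurable
      _ ≤ ∑' k, A * ∫⁻ x, f k x ^ q * MM h x :=
          ENNReal.tsum_le_tsum fun k => weighted q hq (f k) h (hf k) hhm
      _ = A * ∫⁻ x, Φ x * MM h x := by
          rw [ENNReal.tsum_mul_left, ← lintegral_tsum]
          · simp_rw [hΦ, ENNReal.tsum_mul_right]
          · exact fun k => (((hf k).pow_const q).mul (meas_MM h)).aemeasurable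
      _ = A * ∫⁻ x, (Φ x ^ (p/q)) ^ (q/p) * (MM h x ^ r) ^ (1 - q/p) := by
          congr 1
          refine lintegral_congr fun x => ?_
          rw [← ENNReal.rpow_mul, ← ENNReal.rpow_mul, show p/q * (q/p) = 1 by field_simp,
            show r * (1 - q/p) = 1 by rw [hrd]; field_simp, ENNReal.rpow_one, ENNReal.rpow_one]
      _ ≤ A * ((∫⁻ x, Φ x ^ (p/q)) ^ (q/p) * (∫⁻ x, MM h x ^ r) ^ (1 - q/p)) := by
          gcongr
          exact ENNReal.lintegral_mul_norm_pow_le (hΦm.pow_const _).aemeasurable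
            ((meas_MM h).pow_const _).aemeasurable ha.le hb (by ring)
      _ ≤ A * ((∫⁻ x, Φ x ^ (p/q)) ^ (q/p) * (Ar * ∫⁻ x, h x ^ r) ^ (1 - q/p)) := by
          gcongr
          exact scalar r hr h hhm
      _ = A * Ar ^ (1 - q/p) *
          ((∫⁻ x, Φ x ^ (p/q)) ^ (q/p) * (∫⁻ x, Θn n x ^ (p/q)) ^ (1 - q/p)) := by
          have : ∀ x, h x ^ r = Θn n x ^ (p/q) := fun x => by
            rw [hh, ← ENNReal.rpow_mul]
            congr 1
            rw [hrd]; field_simp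
          simp_rw [this]
          rw [ENNReal.mul_rpow_of_nonneg _ _ hb]
          ring
  calc ∫⁻ x, Θ x ^ (p/q) = ⨆ n, ∫⁻ x, Θn n x ^ (p/q) := by
        rw [← lintegral_iSup (fun n => (hΘnm n).pow_const _)
          (fun n k hnk x => ENNReal.rpow_le_rpow (hmono hnk x) hpq0.le)]
        exact lintegral_congr fun x => (hsup x).symm
    _ ≤ _ := iSup_le main

lemma case_top {J : Type*} [Countable J] (d : ℕ) (p : ℝ) (hp : 1 < p)
    (f : J → (Fin d → ℝ) → ℝ≥0∞) (hf : ∀ k, Measurable (f k)) :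
      ∫⁻ x, (⨆ k, MM (f k) x) ^ p ≤ KK p (5 ^ d) * ∫⁻ x, (⨆ k, f k x) ^ p := by
  refine le_trans (lintegral_mono fun x => ?_)
    (scalar p hp (fun x => ⨆ k, f k x) (Measurable.iSup hf))
  refine ENNReal.rpow_le_rpow (iSup_le fun k => MM_mono (fun y => ?_) x) (by linarith)
  exact le_iSup (fun k => f k y) k

end FS

namespace FS

lemma lq_mono {J : Type*} (q : ℝ≥0∞) {g h : J → ℝ≥0∞} (hgh : ∀ k, g k ≤ h k) :
    lqNorm q g ≤ lqNorm q h := by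
  unfold lqNorm
  split_ifs
  · exact iSup_mono hgh
  · refine ENNReal.rpow_le_rpow (ENNReal.tsum_le_tsum fun k => ?_) (by positivity)
    exact ENNReal.rpow_le_rpow (hgh k) ENNReal.toReal_nonneg

lemma lq_smul {J : Type*} (q : ℝ≥0∞) (hq : 1 < q) (c : ℝ≥0∞) (g : J → ℝ≥0∞) :
    lqNorm q (fun k => c * g k) = c * lqNorm q g := by
  unfold lqNorm
  split_ifs with h
  · rw [ENNReal.mul_iSup]
  · have hq0 : 0 < q.toReal := ENNReal.toReal_pos (by positivity) h
    simp_rw [ENNReal.mul_rpow_of_nonneg _ _ hq0.le]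
    rw [ENNReal.tsum_mul_left, ENNReal.mul_rpow_of_nonneg _ _ (by positivity), ← ENNReal.rpow_mul,
      mul_one_div_cancel hq0.ne', ENNReal.rpow_one]

lemma core {J : Type*} [Countable J] (d : ℕ) (p : ℝ) (hp : 1 < p) (q : ℝ≥0∞) (hq : 1 < q) :
    ∃ C : ℝ≥0∞, C ≠ ∞ ∧ ∀ f : J → (Fin d → ℝ) → ℝ≥0∞, (∀ k, Measurable (f k)) →
      ∫⁻ x, (lqNorm q fun k => MM (f k) x) ^ p ≤ C * ∫⁻ x, (lqNorm q fun k => f k x) ^ p := by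
  by_cases h : q = ∞
  · refine ⟨KK p (5 ^ d), KK_ne_top hp (by simp), fun f hf => ?_⟩
    simp only [lqNorm, h, if_true]
    exact case_top d p hp f hf
  · have hq1 : 1 < q.toReal := by
      rw [← ENNReal.toReal_one]
      exact (ENNReal.toReal_lt_toReal (by simp) h).2 hq
    have : ∃ C : ℝ≥0∞, C ≠ ∞ ∧ ∀ f : J → (Fin d → ℝ) → ℝ≥0∞, (∀ k, Measurable (f k)) →
      ∫⁻ x, (∑' k, MM (f k) x ^ q.toReal) ^ (p / q.toReal)
        ≤ C * ∫⁻ x, (∑' k, f k x ^ q.toReal) ^ (p / q.toReal) := by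
      rcases lt_trichotomy p q.toReal with h1 | h1 | h1
      · exact case_lt d p _ hp h1
      · have := case_eq (J := J) d p hp
        rw [← h1, div_self (by positivity)]
        simpa only [ENNReal.rpow_one] using this
      · exact case_gt d p _ hq1 h1
    obtain ⟨C, hC, hf⟩ := this
    refine ⟨C, hC, fun f hm => ?_⟩
    simp only [lqNorm, h, if_false, ← ENNReal.rpow_mul, one_div_mul_eq_div]
    exact hf f hm

lemma cube_le {d : ℕ} (f : (Fin d → ℝ) → ℂ) (g : (Fin d → ℝ) → ℝ≥0∞)
    (hfg : ∀ᵐ x, (‖f x‖₊ : ℝ≥0∞) = g x) (x : Fin d → ℝ) :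
    cubeMaximal f x ≤ 4 ^ d * MM g x := by
  unfold cubeMaximal
  refine iSup_le fun a => iSup_le fun s => iSup_le fun ⟨hs, hx⟩ => ?_
  obtain ⟨r, hr1, hr2⟩ := exists_rat_btwn (show s < 2 * s by linarith)
  have hr0 : (0:ℚ) < r := by exact_mod_cast hs.trans hr1
  have hc : ∀ j, ∃ c : ℚ, a j < c ∧ c < a j + s := fun j => exists_rat_btwn (by linarith)
  choose c hc1 hc2 using hc
  let i : Idx d := (c, ⟨r, hr0⟩)
  have hsub : Set.Icc a (a + Function.const _ s) ⊆ bal i := by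
    intro y hy
    have hr0' : (0:ℝ) ≤ r := by exact_mod_cast hr0.le
    change y ∈ Metric.closedBall (fun j => (c j : ℝ)) (r : ℝ)
    rw [Metric.mem_closedBall, dist_pi_le_iff hr0']
    intro j
    have h1 := hy.1 j
    have h2 := hy.2 j
    simp only [Pi.add_apply, Function.const_apply] at h2
    have := hc1 j
    have := hc2 j
    rw [Real.dist_eq, abs_le]
    constructor <;> linarith
  have hvI : volume (Set.Icc a (a + Function.const _ s)) = ENNReal.ofReal (s ^ d) := by
    rw [Real.volume_Icc_pi]
    simp [ENNReal.ofReal_pow hs.le]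
  have hvB : volume (bal i) ≤ 4 ^ d * volume (Set.Icc a (a + Function.const _ s)) := by
    have hb : volume (bal i) = ENNReal.ofReal ((2 * (r:ℝ)) ^ d) := by
      have := Real.volume_pi_closedBall (cen i) (rad_pos i).le
      rw [Fintype.card_fin] at this
      exact this
    rw [hvI, hb, show (4:ℝ≥0∞) ^ d = ENNReal.ofReal (4 ^ d) by
      rw [ENNReal.ofReal_pow (by norm_num)]; simp, ← ENNReal.ofReal_mul (by positivity), ← mul_pow]
    have hr0' : (0:ℝ) ≤ r := by exact_mod_cast hr0.le
    refine ENNReal.ofReal_le_ofReal (pow_le_pow_left₀ (by positivity) (by linarith) d)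
  have hI0 : volume (Set.Icc a (a + Function.const _ s)) ≠ 0 := by
    rw [hvI]; simp only [ne_eq, ENNReal.ofReal_eq_zero, not_le]; positivity
  have hIt : volume (Set.Icc a (a + Function.const _ s)) ≠ ∞ := by
    rw [hvI]; exact ENNReal.ofReal_ne_top
  rw [ENNReal.div_le_iff hI0 hIt]
  have h2 := le_TT (fun i : Idx d => (volume (bal i))⁻¹) volume g i (hsub hx)
  calc ∫⁻ y in Set.Icc a (a + Function.const _ s), (‖f y‖₊ : ℝ≥0∞)
      = ∫⁻ y in Set.Icc a (a + Function.const _ s), g y :=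
        lintegral_congr_ae (ae_restrict_of_ae hfg)
    _ ≤ ∫⁻ y in bal i, g y := lintegral_mono_set hsub
    _ = volume (bal i) * ((volume (bal i))⁻¹ * ∫⁻ y in bal i, g y) := by
        rw [← mul_assoc, ENNReal.mul_inv_cancel (vol_ne_zero i) (vol_ne_top i), one_mul]
    _ ≤ (4 ^ d * volume (Set.Icc a (a + Function.const _ s))) * MM g x := by
        exact mul_le_mul' hvB h2
    _ = _ := by ring

end FS

theorem stmt_8 (d : ℕ) (p : ℝ) (hp : 1 < p) (q : ℝ≥0∞) (hq : 1 < q) :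
    ∃ C : ℝ≥0∞, 0 < C ∧ C < ∞ ∧
      ∀ f : (Fin d → ℕ) → (Fin d → ℝ) → ℂ,
        (∀ k, LocallyIntegrable (f k) volume) →
        (∫⁻ x, (lqNorm q fun k => cubeMaximal (f k) x) ^ p) ^ (1 / p)
          ≤ C * (∫⁻ x, (lqNorm q fun k => (‖f k x‖₊ : ℝ≥0∞)) ^ p) ^ (1 / p) := by
  have hp0 : 0 < p := by linarith
  obtain ⟨C, hC, hcore⟩ := FS.core (J := Fin d → ℕ) d p hp q hq
  have h4 : ((4:ℝ≥0∞) ^ d) ^ p ≠ ∞ := ENNReal.rpow_ne_top_of_nonneg hp0.le (by simp)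
  refine ⟨(((4:ℝ≥0∞) ^ d) ^ p * C) ^ (1/p) + 1, by positivity, ?_, fun f hf => ?_⟩
  · refine ENNReal.add_lt_top.2 ⟨?_, by simp⟩
    exact (ENNReal.rpow_ne_top_of_nonneg (by positivity) (ENNReal.mul_ne_top h4 hC)).lt_top
  have hae : ∀ k, AEMeasurable (fun x => (‖f k x‖₊ : ℝ≥0∞)) volume := fun k =>
    (hf k).aestronglyMeasurable.enorm
  have hall : ∀ᵐ x, ∀ k, (‖f k x‖₊ : ℝ≥0∞) = (hae k).mk _ x :=
    ae_all_iff.2 fun k => (hae k).ae_eq_mk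
  have hR : ∫⁻ x, (lqNorm q fun k => (‖f k x‖₊ : ℝ≥0∞)) ^ p
      = ∫⁻ x, (lqNorm q fun k => (hae k).mk _ x) ^ p := by
    refine lintegral_congr_ae ?_
    filter_upwards [hall] with x hx
    simp_rw [hx]
  have hL : ∫⁻ x, (lqNorm q fun k => cubeMaximal (f k) x) ^ p
      ≤ (((4:ℝ≥0∞) ^ d) ^ p * C) * ∫⁻ x, (lqNorm q fun k => (‖f k x‖₊ : ℝ≥0∞)) ^ p := by
    rw [hR, mul_assoc]
    refine le_trans ?_ (mul_le_mul_right (hcore _ fun k => (hae k).measurable_mk) _)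
    rw [← lintegral_const_mul' _ _ h4]
    refine lintegral_mono fun x => ?_
    rw [← ENNReal.mul_rpow_of_nonneg _ _ hp0.le, ← FS.lq_smul q hq]
    refine ENNReal.rpow_le_rpow (FS.lq_mono q fun k => ?_) hp0.le
    exact FS.cube_le _ _ (hae k).ae_eq_mk x
  refine (ENNReal.rpow_le_rpow hL (by positivity)).trans ?_
  rw [ENNReal.mul_rpow_of_nonneg _ _ (by positivity)]
  gcongr
  exact le_self_add
end

section
/- Let 1 < p < ∞ with conjugate p'. The canonical map from L^p(ℓ^1) into the dual of L^{p'}(c_0) given by ⟨(g_k), (ψ_k)⟩ = ∑_k ∫ g_k ψ_k is a linear isometry; moreover every continuous linear functional on L^{p'}(c_0) arises this way, i.e., (L^{p'}(c_0))' = L^{p}(ℓ^1) isometrically. -/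
open MeasureTheory ENNReal Filter

/-- Membership in `L^{p'}(c₀)`: a family of (a.e. strongly measurable) functions whose
values tend to `0` a.e. as `|k|₁ → ∞` (i.e. along the cofinite filter on `ℕ₀^d`). -/
def MemLc0 {d : ℕ} (ψ : (Fin d → ℕ) → (Fin d → ℝ) → ℂ) : Prop :=
  (∀ k, AEStronglyMeasurable (ψ k) volume) ∧
    ∀ᵐ x : Fin d → ℝ, Tendsto (fun k => ‖ψ k x‖) cofinite (nhds 0)

/-- The norm of `L^{p'}(c₀)`: `‖sup_k |ψ_k|‖_{L^{p'}}`. -/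
noncomputable def lc0Norm {d : ℕ} (p' : ℝ) (ψ : (Fin d → ℕ) → (Fin d → ℝ) → ℂ) : ℝ≥0∞ :=
  (∫⁻ x : Fin d → ℝ, (⨆ k, (‖ψ k x‖₊ : ℝ≥0∞)) ^ p') ^ (1 / p')

/-- The norm of `L^p(ℓ¹)`: `‖∑_k |g_k|‖_{L^p}`. -/
noncomputable def lpl1Norm {d : ℕ} (p : ℝ) (g : (Fin d → ℕ) → (Fin d → ℝ) → ℂ) : ℝ≥0∞ :=
  (∫⁻ x : Fin d → ℝ, (∑' k, (‖g k x‖₊ : ℝ≥0∞)) ^ p) ^ (1 / p)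


lemma core_tendsto {α ι : Type*} [MeasurableSpace α] {μ : Measure α} {l : Filter ι}
    [l.IsCountablyGenerated] {q C : ℝ} (hq : 0 < q)
    (Ψ : ι → ℂ) (N : ι → α → ℝ≥0∞) (M : α → ℝ≥0∞)
    (hM : ∫⁻ x, M x ^ q ∂μ < ∞) (hN : ∀ i, AEMeasurable (N i) μ)
    (hb : ∀ i, ∀ᵐ x ∂μ, N i x ≤ M x)
    (hl : ∀ᵐ x ∂μ, Tendsto (fun i => N i x) l (nhds 0))
    (hΨ : ∀ i, ∫⁻ x, N i x ^ q ∂μ < ∞ → ‖Ψ i‖ ≤ C * ((∫⁻ x, N i x ^ q ∂μ) ^ (1 / q)).toReal) :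
    Tendsto Ψ l (nhds 0) := by
  have hfin : ∀ i, ∫⁻ x, N i x ^ q ∂μ < ∞ := fun i => by
    refine lt_of_le_of_lt (lintegral_mono_ae ?_) hM
    filter_upwards [hb i] with x hx
    gcongr
  have h1 : Tendsto (fun i => ∫⁻ x, N i x ^ q ∂μ) l (nhds (∫⁻ x, (0:ℝ≥0∞) ∂μ)) := by
    refine tendsto_lintegral_filter_of_dominated_convergence' (fun x => M x ^ q)
      (Eventually.of_forall fun i => (hN i).pow_const _) (Eventually.of_forall fun i => ?_)
      hM.ne ?_
    · filter_upwards [hb i] with x hx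
      gcongr
    · filter_upwards [hl] with x hx
      have := hx.ennrpow_const q
      rwa [ENNReal.zero_rpow_of_pos hq] at this
  rw [lintegral_zero] at h1
  have h2 := h1.ennrpow_const (1 / q)
  rw [ENNReal.zero_rpow_of_pos (by positivity)] at h2
  have h3 := (ENNReal.tendsto_toReal ENNReal.zero_ne_top).comp h2
  have h4 := h3.const_mul C
  simp only [ENNReal.toReal_zero, mul_zero] at h4
  exact squeeze_zero_norm (fun i => hΨ i (hfin i)) h4

lemma rn_exists {α : Type*} [MeasurableSpace α] {μ : Measure α} [SigmaFinite μ]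
    (N : Set α → ℝ) (h0 : N ∅ = 0)
    (hU : ∀ f : ℕ → Set α, (∀ i, MeasurableSet (f i)) → Pairwise (Function.onFun Disjoint f) →
      HasSum (fun i => N (f i)) (N (⋃ i, f i)))
    (hac : ∀ A, MeasurableSet A → μ A = 0 → N A = 0) :
    ∃ r : α → ℝ, Integrable r μ ∧ ∀ A, MeasurableSet A → N A = ∫ x in A, r x ∂μ := by
  classical
  let s : SignedMeasure α :=
    { measureOf' := fun A => if MeasurableSet A then N A else 0
      empty' := by simp [h0]
      not_measurable' := fun A hA => if_neg hA
      m_iUnion' := fun f hf hd => by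
        simp only [hf, MeasurableSet.iUnion hf, if_true]
        exact hU f hf hd }
  have hs : ∀ A, MeasurableSet A → s A = N A := fun A hA => if_pos hA
  have hsac : s ≪ᵥ μ.toENNRealVectorMeasure := by
    refine VectorMeasure.AbsolutelyContinuous.mk fun A hA h => ?_
    rw [Measure.toENNRealVectorMeasure_apply_measurable hA] at h
    rw [hs A hA, hac A hA h]
  have := SignedMeasure.withDensityᵥ_rnDeriv_eq s μ hsac
  refine ⟨s.rnDeriv μ, SignedMeasure.integrable_rnDeriv _ _, fun A hA => ?_⟩
  rw [← hs A hA, ← withDensityᵥ_apply (SignedMeasure.integrable_rnDeriv _ _) hA, this]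

/-- scalar representation on functions dominated by a multiple of `h` -/
lemma scalar_rep {α : Type*} [MeasurableSpace α] {μ : Measure α} [SigmaFinite μ]
    {q C : ℝ} (hq : 0 < q) (Φ : (α → ℂ) →ₗ[ℂ] ℂ)
    (hΦ : ∀ f, AEStronglyMeasurable f μ → ∫⁻ x, ‖f x‖ₑ ^ q ∂μ < ∞ →
      ‖Φ f‖ ≤ C * ((∫⁻ x, ‖f x‖ₑ ^ q ∂μ) ^ (1 / q)).toReal)
    (h : α → ℂ) (hm : Measurable h) (hh : ∫⁻ x, ‖h x‖ₑ ^ q ∂μ < ∞) :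
    ∃ r : α → ℂ, Measurable r ∧ Integrable r μ ∧ ∀ (φ : α → ℂ) (c : ℝ), AEStronglyMeasurable φ μ →
      (∀ x, ‖φ x‖ ≤ c) → Φ (fun x => φ x * h x) = ∫ x, φ x * r x ∂μ := by
  classical
  -- continuity
  have hcont : ∀ {ι : Type} (l : Filter ι) [l.IsCountablyGenerated] (θ : ι → α → ℂ) (θ' : α → ℂ) (c : ℝ), (∀ i, AEStronglyMeasurable (θ i) μ) →
      AEStronglyMeasurable θ' μ →
      (∀ i, ∀ᵐ x ∂μ, ‖θ i x‖ ≤ c) → (∀ᵐ x ∂μ, ‖θ' x‖ ≤ c) →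
      (∀ᵐ x ∂μ, Tendsto (fun i => θ i x) l (nhds (θ' x))) →
      Tendsto (fun i => Φ (fun x => θ i x * h x)) l (nhds (Φ (fun x => θ' x * h x))) := by
    intro ι l _ θ θ' c h1 h1' h2 h2' h3
    rw [← tendsto_sub_nhds_zero_iff]
    refine core_tendsto (μ := μ) (C := C) hq _ (fun i x => ‖(θ i x - θ' x) * h x‖ₑ)
      (fun x => ENNReal.ofReal (2 * c) * ‖h x‖ₑ) ?_ ?_ ?_ ?_ ?_
    · simp_rw [ENNReal.mul_rpow_of_nonneg _ _ hq.le]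
      rw [lintegral_const_mul' _ _ (by finiteness)]
      exact ENNReal.mul_lt_top (by finiteness) hh
    · intro i
      exact (((h1 i).sub h1').mul hm.aestronglyMeasurable).enorm
    · intro i
      filter_upwards [h2 i, h2'] with x hx hx'
      rw [enorm_mul]
      gcongr
      rw [← ofReal_norm]
      refine ENNReal.ofReal_le_ofReal ((norm_sub_le _ _).trans (by linarith))
    · filter_upwards [h3] with x hx
      have : Tendsto (fun i => ‖(θ i x - θ' x) * h x‖ₑ) l (nhds ‖(θ' x - θ' x) * h x‖ₑ) :=
        ((hx.sub_const _).mul_const _).enorm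
      simpa using this
    · intro i hi
      rw [← map_sub]
      have e : ((fun x => θ i x * h x) - fun x => θ' x * h x) = fun x => (θ i x - θ' x) * h x := by
        ext x; simp [sub_mul]
      rw [e]
      exact hΦ _ (((h1 i).sub h1').mul hm.aestronglyMeasurable) hi
  let T : Set α → ℂ := fun A => Φ (fun x => A.indicator (fun _ => (1:ℂ)) x * h x)
  have hT0 : T ∅ = 0 := by
    have : (fun x => (∅ : Set α).indicator (fun _ => (1:ℂ)) x * h x) = 0 := by ext; simp
    simp only [T, this, map_zero]
  have hTac : ∀ A, MeasurableSet A → μ A = 0 → T A = 0 := by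
    intro A hA hA0
    have e : ∫⁻ x, ‖A.indicator (fun _ => (1:ℂ)) x * h x‖ₑ ^ q ∂μ = 0 := by
      rw [lintegral_eq_zero_iff' (by fun_prop (disch := assumption))]
      have : ∀ᵐ x ∂μ, x ∉ A := measure_eq_zero_iff_ae_notMem.1 hA0
      filter_upwards [this] with x hx
      simp [hx, hq]
    have := hΦ (fun x => A.indicator (fun _ => (1:ℂ)) x * h x)
      (by fun_prop (disch := assumption)) (by rw [e]; simp)
    rw [e] at this
    rw [ENNReal.zero_rpow_of_pos (by positivity)] at this
    simpa using this
  have hTU : ∀ f : ℕ → Set α, (∀ i, MeasurableSet (f i)) → Pairwise (Function.onFun Disjoint f) →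
      HasSum (fun i => T (f i)) (T (⋃ i, f i)) := by
    intro f hf hd
    have hle : ∀ (B : Set α) (x : α), ‖B.indicator (fun _ => (1:ℂ)) x‖ ≤ 1 := by
      intro B x
      by_cases hx : x ∈ B <;> simp [hx]
    have := hcont (atTop : Filter (Finset ℕ))
      (fun S x => (⋃ i ∈ S, f i).indicator (fun _ => (1:ℂ)) x)
      (fun x => (⋃ i, f i).indicator (fun _ => (1:ℂ)) x) 1
      (fun S => (measurable_const.indicator
        (Finset.measurableSet_biUnion S (fun i _ => hf i))).aestronglyMeasurable)
      ((measurable_const.indicator (MeasurableSet.iUnion hf)).aestronglyMeasurable)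
      (fun S => Eventually.of_forall fun x => hle _ x)
      (Eventually.of_forall fun x => hle _ x)
      (Eventually.of_forall fun x => by
        exact (tendsto_indicator_biUnion_finset f (fun _ => (1:ℂ)) x).mono_right (pure_le_nhds _))
    refine Tendsto.congr (fun S => ?_) this
    simp only [T]
    rw [← map_sum]
    congr 1
    ext x
    rw [Finset.sum_apply, Finset.indicator_biUnion S f (fun i _ j _ hij => hd hij), Finset.sum_mul]
  obtain ⟨r1, hr1, hr1'⟩ := rn_exists (μ := μ) (fun A => (T A).re) (by simp [hT0])
    (fun f hf hd => Complex.hasSum_re (hTU f hf hd)) (fun A hA h => by simp [hTac A hA h])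
  obtain ⟨r2, hr2, hr2'⟩ := rn_exists (μ := μ) (fun A => (T A).im) (by simp [hT0])
    (fun f hf hd => Complex.hasSum_im (hTU f hf hd)) (fun A hA h => by simp [hTac A hA h])
  let r0 : α → ℂ := fun x => r1 x + r2 x * Complex.I
  have hr0 : Integrable r0 μ := hr1.ofReal.add (hr2.ofReal.mul_const _)
  let r : α → ℂ := hr0.1.mk
  have hrm : Measurable r := hr0.1.stronglyMeasurable_mk.measurable
  have hr : Integrable r μ := hr0.congr hr0.1.ae_eq_mk
  have hTr : ∀ A, MeasurableSet A → T A = ∫ x in A, r x ∂μ := by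
    intro A hA
    have : ∫ x in A, r x ∂μ = ∫ x in A, r0 x ∂μ :=
      integral_congr_ae (ae_restrict_of_ae hr0.1.ae_eq_mk.symm)
    rw [this]
    simp only [r0]
    rw [integral_add hr1.ofReal.restrict (hr2.ofReal.mul_const _).restrict,
      integral_mul_const, integral_complex_ofReal, integral_complex_ofReal, ← hr1' A hA,
      ← hr2' A hA, Complex.re_add_im]
  refine ⟨r, hrm, hr, ?_⟩
  have hsimple : ∀ s : SimpleFunc α ℂ, Φ (fun x => s x * h x) = ∫ x, s x * r x ∂μ := by
    intro s
    induction s using SimpleFunc.induction with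
    | const a hA =>
      rename_i A
      have e1 : (fun x => (SimpleFunc.piecewise A hA (SimpleFunc.const α a)
          (SimpleFunc.const α 0)) x * h x)
          = a • (fun x => A.indicator (fun _ => (1:ℂ)) x * h x) := by
        ext x
        by_cases hx : x ∈ A <;> simp [hx]
      have e2 : (fun x => (SimpleFunc.piecewise A hA (SimpleFunc.const α a)
          (SimpleFunc.const α 0)) x * r x)
          = A.indicator (fun x => a * r x) := by
        ext x
        by_cases hx : x ∈ A <;> simp [hx]
      rw [e1, e2, map_smul, integral_indicator hA, integral_const_mul, ← hTr A hA, smul_eq_mul]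
    | add _ hf hg =>
      rename_i f g _
      have e1 : (fun x => (f + g) x * h x) = (fun x => f x * h x) + fun x => g x * h x := by
        ext x; simp [add_mul]
      have hi : ∀ f : SimpleFunc α ℂ, Integrable (fun x => f x * r x) μ := by
        intro f
        obtain ⟨c, hc⟩ := f.exists_forall_norm_le
        exact hr.bdd_mul f.measurable.aestronglyMeasurable (Eventually.of_forall hc)
      rw [e1, map_add, hf, hg, ← integral_add (hi f) (hi g)]
      congr 1
      ext x; simp [add_mul]
  intro φ c hφ hc
  obtain ⟨φ', hφ', hφφ'⟩ := hφ
  have hc' : ∀ᵐ x ∂μ, ‖φ' x‖ ≤ max c 0 := by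
    filter_upwards [hφφ'] with x hx
    rw [← hx]
    exact (hc x).trans (le_max_left _ _)
  have hlim : ∀ᵐ x ∂μ, Tendsto (fun n => hφ'.approxBounded (max c 0) n x) atTop (nhds (φ x)) := by
    filter_upwards [hφ'.tendsto_approxBounded_ae hc', hφφ'] with x hx hx'
    rwa [hx']
  have hb : ∀ n x, ‖hφ'.approxBounded (max c 0) n x‖ ≤ max c 0 := fun n x =>
    hφ'.norm_approxBounded_le (le_max_right _ _) n x
  have l1 := hcont atTop (fun n x => hφ'.approxBounded (max c 0) n x) φ (max c 0)
    (fun n => (SimpleFunc.measurable _).aestronglyMeasurable) ⟨φ', hφ', hφφ'⟩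
    (fun n => Eventually.of_forall (hb n))
    (Eventually.of_forall fun x => (hc x).trans (le_max_left _ _)) hlim
  have l2 : Tendsto (fun n => ∫ x, hφ'.approxBounded (max c 0) n x * r x ∂μ) atTop
      (nhds (∫ x, φ x * r x ∂μ)) := by
    refine tendsto_integral_of_dominated_convergence (fun x => max c 0 * ‖r x‖)
      (fun n => (SimpleFunc.measurable _).aestronglyMeasurable.mul hrm.aestronglyMeasurable)
      (hr.norm.const_mul _) (fun n => Eventually.of_forall fun x => ?_) ?_
    · rw [norm_mul]
      gcongr
      exact hb n x
    · filter_upwards [hlim] with x hx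
      exact hx.mul_const _
  simp_rw [hsimple] at l1
  exact tendsto_nhds_unique l1 l2

lemma holder_part {d : ℕ} {p p' : ℝ} (hc : p.HolderConjugate p')
    (g ψ : (Fin d → ℕ) → (Fin d → ℝ) → ℂ) (hg : ∀ k, AEStronglyMeasurable (g k) volume)
    (hψ : ∀ k, AEStronglyMeasurable (ψ k) volume) :
    (∑' k, ∫⁻ x, (‖g k x‖₊ : ℝ≥0∞) * (‖ψ k x‖₊ : ℝ≥0∞)) ≤ lpl1Norm p g * lc0Norm p' ψ := by
  rw [← lintegral_tsum (f := fun k x => (‖g k x‖₊ : ℝ≥0∞) * (‖ψ k x‖₊ : ℝ≥0∞))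
    (fun k => (hg k).enorm.mul (hψ k).enorm)]
  refine le_trans (lintegral_mono (fun x => ?_))
    (ENNReal.lintegral_mul_le_Lp_mul_Lq volume hc
      (f := fun x => ∑' k, (‖g k x‖₊ : ℝ≥0∞)) (g := fun x => ⨆ k, (‖ψ k x‖₊ : ℝ≥0∞)) ?_ ?_)
  · simp only [Pi.mul_apply]
    rw [← ENNReal.tsum_mul_right]
    refine ENNReal.tsum_le_tsum fun k => ?_
    gcongr
    exact le_iSup (fun k => (‖ψ k x‖₊ : ℝ≥0∞)) k
  · exact AEMeasurable.ennreal_tsum fun k => (hg k).enorm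
  · exact AEMeasurable.iSup fun k => (hψ k).enorm

lemma lpl1_le {d : ℕ} {p : ℝ} (hp : 0 < p)
    (g : (Fin d → ℕ) → (Fin d → ℝ) → ℂ) (hg : ∀ k, AEStronglyMeasurable (g k) volume)
    (D : ℝ≥0∞) (h : ∀ S : Finset (Fin d → ℕ), ∫⁻ x, (∑ k ∈ S, ‖g k x‖ₑ) ^ p ≤ D) :
    lpl1Norm p g ≤ D ^ (1 / p) := by
  unfold lpl1Norm
  gcongr
  have : ∀ x, (∑' k, (‖g k x‖₊ : ℝ≥0∞)) ^ p
      = ⨆ S : Finset (Fin d → ℕ), (∑ k ∈ S, ‖g k x‖ₑ) ^ p := by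
    intro x
    rw [ENNReal.tsum_eq_iSup_sum]
    exact (ENNReal.orderIsoRpow p hp).map_iSup _
  simp_rw [this]
  rw [lintegral_iSup_directed]
  · exact iSup_le h
  · intro S
    exact (Finset.aemeasurable_fun_sum S fun k _ => (hg k).enorm).pow_const _
  · refine Monotone.directed_le ?_
    intro S T hST x
    dsimp only
    gcongr

lemma norming {d : ℕ} {p p' : ℝ} (hc : p.HolderConjugate p')
    (g : (Fin d → ℕ) → (Fin d → ℝ) → ℂ) (hg : ∀ k, AEStronglyMeasurable (g k) volume)
    (S : Finset (Fin d → ℕ)) (E : Set (Fin d → ℝ)) (hE : MeasurableSet E)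
    (I : ℝ≥0∞) (hI : ∫⁻ x in E, (∑ k ∈ S, ‖g k x‖ₑ) ^ p = I) (hIf : I < ∞) :
    ∃ ψ : (Fin d → ℕ) → (Fin d → ℝ) → ℂ, MemLc0 ψ ∧ lc0Norm p' ψ ≤ I ^ (1 / p') ∧
      (∀ k, k ∉ S → ψ k = 0) ∧ (∀ k x, x ∉ E → ψ k x = 0) ∧
      (∀ k x, ‖ψ k x‖ ≤ (∑ k ∈ S, ‖g k x‖) ^ (p - 1)) ∧
      ∑ k ∈ S, ∫ x, g k x * ψ k x = (I.toReal : ℂ) := by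
  classical
  have hp : 0 < p := hc.pos
  have hp1 : 0 < p - 1 := by linarith [hc.lt]
  have hp' : 0 < p' := hc.symm.pos
  let A : (Fin d → ℝ) → ℝ := fun x => ∑ k ∈ S, ‖g k x‖
  have hA0 : ∀ x, 0 ≤ A x := fun x => Finset.sum_nonneg fun k _ => norm_nonneg _
  have hAm : AEMeasurable A volume := Finset.aemeasurable_fun_sum S fun k _ => (hg k).norm.aemeasurable
  have hAe : ∀ x, ∑ k ∈ S, ‖g k x‖ₑ = ENNReal.ofReal (A x) := by
    intro x
    simp only [A]
    rw [ENNReal.ofReal_sum_of_nonneg (fun k _ => norm_nonneg _)]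
    simp
  have hAI : ∫⁻ x, ENNReal.ofReal (E.indicator (fun x => A x ^ p) x) = I := by
    rw [← hI, ← lintegral_indicator hE]
    congr 1
    ext x
    by_cases hx : x ∈ E
    · simp only [hx, Set.indicator_of_mem, hAe, ENNReal.ofReal_rpow_of_nonneg (hA0 x) hp.le]
    · simp [hx]
  have hApm : AEMeasurable (E.indicator (fun x => A x ^ p)) volume := (hAm.pow_const p).indicator hE
  have hint : Integrable (E.indicator (fun x => A x ^ p)) volume := by
    refine ⟨hApm.aestronglyMeasurable, ?_⟩
    rw [hasFiniteIntegral_iff_ofReal (Eventually.of_forall fun x =>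
      Set.indicator_nonneg (fun x _ => Real.rpow_nonneg (hA0 x) _) x), hAI]
    exact hIf
  let ψ : (Fin d → ℕ) → (Fin d → ℝ) → ℂ := fun k =>
    if k ∈ S then E.indicator (fun x => (starRingEnd ℂ (g k x) / (‖g k x‖ : ℂ)) * ((A x ^ (p - 1) : ℝ) : ℂ))
    else 0
  have hψS : ∀ k, k ∉ S → ψ k = 0 := fun k hk => if_neg hk
  have hψE : ∀ k x, x ∉ E → ψ k x = 0 := fun k x hx => by
    by_cases hk : k ∈ S <;> simp [ψ, hk, hx]
  have hψm : ∀ k, AEStronglyMeasurable (ψ k) volume := by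
    intro k
    by_cases hk : k ∈ S
    · simp only [ψ, hk, if_true]
      refine AEStronglyMeasurable.indicator ?_ hE
      refine AEMeasurable.aestronglyMeasurable ?_
      refine AEMeasurable.mul (AEMeasurable.div ?_ ?_) ?_
      · exact Complex.continuous_conj.measurable.comp_aemeasurable (hg k).aemeasurable
      · exact Complex.measurable_ofReal.comp_aemeasurable (hg k).norm.aemeasurable
      · exact Complex.measurable_ofReal.comp_aemeasurable (hAm.pow_const _)
    · rw [hψS k hk]; exact aestronglyMeasurable_zero
  have hψb : ∀ k x, ‖ψ k x‖ ≤ E.indicator (fun x => A x ^ (p - 1)) x := by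
    intro k x
    by_cases hk : k ∈ S
    · by_cases hx : x ∈ E
      · simp only [ψ, hk, if_true, hx, Set.indicator_of_mem, norm_mul, norm_div, RCLike.norm_conj,
          Complex.norm_real, norm_norm, Real.norm_of_nonneg (Real.rpow_nonneg (hA0 x) _)]
        exact mul_le_of_le_one_left (Real.rpow_nonneg (hA0 x) _) (div_self_le_one _)
      · simp [hψE k x hx, hx]
    · rw [hψS k hk]
      simpa using Set.indicator_nonneg (fun x _ => Real.rpow_nonneg (hA0 x) _) x
  have hmul : ∀ k ∈ S, ∀ x, g k x * ψ k x
      = ((E.indicator (fun x => ‖g k x‖ * A x ^ (p - 1)) x : ℝ) : ℂ) := by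
    intro k hk x
    by_cases hx : x ∈ E
    · simp only [ψ, hk, if_true, hx, Set.indicator_of_mem]
      by_cases h0 : g k x = 0
      · simp [h0]
      · rw [← mul_assoc, mul_div_assoc', Complex.mul_conj, Complex.normSq_eq_norm_sq]
        have : (‖g k x‖ : ℂ) ≠ 0 := by simpa using h0
        push_cast
        field_simp
    · simp [hψE k x hx, hx]
  have hApow : ∀ x, A x * A x ^ (p - 1) = A x ^ p := by
    intro x
    rcases (hA0 x).eq_or_lt with h | h
    · rw [← h, Real.zero_rpow hp.ne']; simp
    · rw [← Real.rpow_one_add' (hA0 x) (by linarith)]; congr 1; ring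
  refine ⟨ψ, ⟨hψm, Eventually.of_forall fun x => ?_⟩, ?_, hψS, hψE, fun k x => ?_, ?_⟩
  · refine tendsto_const_nhds.congr' ?_
    have : ∀ᶠ k in (cofinite : Filter (Fin d → ℕ)), k ∉ S := S.finite_toSet.compl_mem_cofinite
    filter_upwards [this] with k hk
    simp [hψS k hk]
  · unfold lc0Norm
    gcongr
    rw [← hAI]
    refine lintegral_mono fun x => ?_
    have h1 : (⨆ k, (‖ψ k x‖₊ : ℝ≥0∞)) ≤ ENNReal.ofReal (E.indicator (fun x => A x ^ (p - 1)) x) := by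
      refine iSup_le fun k => ?_
      rw [← enorm_eq_nnnorm, ← ofReal_norm]
      exact ENNReal.ofReal_le_ofReal (hψb k x)
    refine (ENNReal.rpow_le_rpow h1 hp'.le).trans ?_
    by_cases hx : x ∈ E
    · simp only [hx, Set.indicator_of_mem]
      rw [ENNReal.ofReal_rpow_of_nonneg (Real.rpow_nonneg (hA0 x) _) hp'.le, ← Real.rpow_mul (hA0 x),
        hc.sub_one_mul_conj]
    · simp [hx, hp']
  · refine (hψb k x).trans ?_
    exact Set.indicator_le_self' (fun x _ => Real.rpow_nonneg (hA0 x) _) x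
  · have hik : ∀ k ∈ S, Integrable (E.indicator (fun x => ‖g k x‖ * A x ^ (p - 1))) volume := by
      intro k hk
      refine hint.mono' ((((hg k).norm.aemeasurable.mul (hAm.pow_const _)).indicator hE).aestronglyMeasurable)
        (Eventually.of_forall fun x => ?_)
      by_cases hx : x ∈ E
      · simp only [hx, Set.indicator_of_mem]
        rw [Real.norm_of_nonneg (mul_nonneg (norm_nonneg _) (Real.rpow_nonneg (hA0 x) _)), ← hApow]
        refine mul_le_mul_of_nonneg_right ?_ (Real.rpow_nonneg (hA0 x) _)
        exact Finset.single_le_sum (f := fun k => ‖g k x‖) (fun k _ => norm_nonneg _) hk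
      · simp [hx]
    have e1 : ∀ k ∈ S, ∫ x, g k x * ψ k x
        = ((∫ x, E.indicator (fun x => ‖g k x‖ * A x ^ (p - 1)) x : ℝ) : ℂ) := by
      intro k hk
      simp_rw [hmul k hk]
      exact integral_complex_ofReal
    rw [Finset.sum_congr rfl e1, ← Complex.ofReal_sum, ← integral_finsetSum _ hik]
    congr 1
    have e2 : (fun x => ∑ k ∈ S, E.indicator (fun x => ‖g k x‖ * A x ^ (p - 1)) x)
        = E.indicator (fun x => A x ^ p) := by
      ext x
      by_cases hx : x ∈ E
      · simp only [hx, Set.indicator_of_mem]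
        rw [← Finset.sum_mul, ← hApow]
      · simp [hx]
    rw [e2, ← hAI]
    exact integral_eq_lintegral_of_nonneg_ae (Eventually.of_forall fun x =>
      Set.indicator_nonneg (fun x _ => Real.rpow_nonneg (hA0 x) _) x) hApm.aestronglyMeasurable

lemma lc0Norm_smul {d : ℕ} {p' : ℝ} (hp' : 0 < p') (c : ℂ)
    (ψ : (Fin d → ℕ) → (Fin d → ℝ) → ℂ) :
    lc0Norm p' (c • ψ) = ‖c‖ₑ * lc0Norm p' ψ := by
  unfold lc0Norm
  have : ∀ x, (⨆ k, (‖(c • ψ) k x‖₊ : ℝ≥0∞)) ^ p'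
      = ‖c‖ₑ ^ p' * (⨆ k, (‖ψ k x‖₊ : ℝ≥0∞)) ^ p' := by
    intro x
    rw [← ENNReal.mul_rpow_of_nonneg _ _ hp'.le, ENNReal.mul_iSup]
    congr 2
    ext k
    simp [enorm_eq_nnnorm]
  simp_rw [this]
  rw [lintegral_const_mul' _ _ (by finiteness), ENNReal.mul_rpow_of_nonneg _ _ (by positivity),
    ← ENNReal.rpow_mul]
  field_simp
  simp

lemma part_b {d : ℕ} {p p' : ℝ} (hc : p.HolderConjugate p')
    (g : (Fin d → ℕ) → (Fin d → ℝ) → ℂ) (hg : ∀ k, AEStronglyMeasurable (g k) volume)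
    (hgf : lpl1Norm p g < ∞) :
    (⨆ (ψ : (Fin d → ℕ) → (Fin d → ℝ) → ℂ)
            (_ : MemLc0 ψ ∧ lc0Norm p' ψ ≤ 1),
          ENNReal.ofReal ‖∑' k, ∫ x : Fin d → ℝ, g k x * ψ k x‖) = lpl1Norm p g := by
  have hp : 0 < p := hc.pos
  have hp' : 0 < p' := hc.symm.pos
  apply le_antisymm
  · refine iSup₂_le fun ψ hψ => ?_
    calc ENNReal.ofReal ‖∑' k, ∫ x : Fin d → ℝ, g k x * ψ k x‖
        = ‖∑' k, ∫ x : Fin d → ℝ, g k x * ψ k x‖ₑ := ofReal_norm _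
      _ ≤ ∑' k, ‖∫ x : Fin d → ℝ, g k x * ψ k x‖ₑ := enorm_tsum_le_tsum_enorm
      _ ≤ ∑' k, ∫⁻ x, (‖g k x‖₊ : ℝ≥0∞) * (‖ψ k x‖₊ : ℝ≥0∞) := by
        refine ENNReal.tsum_le_tsum fun k => (enorm_integral_le_lintegral_enorm _).trans ?_
        simp_rw [enorm_mul]
        exact le_rfl
      _ ≤ lpl1Norm p g * lc0Norm p' ψ := holder_part hc g ψ hg hψ.1.1
      _ ≤ lpl1Norm p g * 1 := by gcongr; exact hψ.2
      _ = lpl1Norm p g := mul_one _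
  · set B := (⨆ (ψ : (Fin d → ℕ) → (Fin d → ℝ) → ℂ)
            (_ : MemLc0 ψ ∧ lc0Norm p' ψ ≤ 1),
          ENNReal.ofReal ‖∑' k, ∫ x : Fin d → ℝ, g k x * ψ k x‖) with hB
    have key : ∀ S : Finset (Fin d → ℕ), ∫⁻ x, (∑ k ∈ S, ‖g k x‖ₑ) ^ p ≤ B ^ p := by
      intro S
      set I := ∫⁻ x, (∑ k ∈ S, ‖g k x‖ₑ) ^ p with hI
      have hIf : I < ∞ := by
        have h1 : I ≤ ∫⁻ x, (∑' k, (‖g k x‖₊ : ℝ≥0∞)) ^ p := by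
          refine lintegral_mono fun x => ?_
          gcongr
          exact ENNReal.sum_le_tsum S
        refine h1.trans_lt ?_
        exact (ENNReal.rpow_lt_top_iff_of_pos (by positivity)).1 hgf
      rcases eq_or_ne I 0 with h0 | h0
      · rw [h0]; exact zero_le
      obtain ⟨ψ, hψ, hψn, hψS, -, -, hψI⟩ := norming hc g hg S Set.univ MeasurableSet.univ I
        (by rw [Measure.restrict_univ]) hIf
      have hIr : 0 < I.toReal := ENNReal.toReal_pos h0 hIf.ne
      let c : ℝ := I.toReal ^ (-(1 / p'))
      have hcpos : 0 < c := Real.rpow_pos_of_pos hIr _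
      have hce : ‖(c : ℂ)‖ₑ = I ^ (-(1 / p')) := by
        rw [← ofReal_norm, Complex.norm_real, Real.norm_of_nonneg hcpos.le,
          ← ENNReal.ofReal_rpow_of_pos hIr, ENNReal.ofReal_toReal hIf.ne]
      have hmem : MemLc0 ((c : ℂ) • ψ) := by
        refine ⟨fun k => (hψ.1 k).const_smul (c : ℂ), ?_⟩
        filter_upwards [hψ.2] with x hx
        simpa [norm_mul] using hx.const_mul ‖(c:ℂ)‖
      have hn : lc0Norm p' ((c : ℂ) • ψ) ≤ 1 := by
        rw [lc0Norm_smul hp', hce]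
        calc _ ≤ I ^ (-(1 / p')) * I ^ (1 / p') := by gcongr
          _ = 1 := by rw [← ENNReal.rpow_add _ _ h0 hIf.ne]; simp
      have hv : ∑' k, ∫ x : Fin d → ℝ, g k x * ((c : ℂ) • ψ) k x = ((c * I.toReal : ℝ) : ℂ) := by
        rw [tsum_eq_sum (s := S) (fun k hk => by simp [hψS k hk])]
        push_cast
        rw [← hψI, Finset.mul_sum]
        refine Finset.sum_congr rfl fun k _ => ?_
        rw [← integral_const_mul]
        congr 1
        ext x
        simp; ring
      have hle : ENNReal.ofReal ‖∑' k, ∫ x : Fin d → ℝ, g k x * ((c : ℂ) • ψ) k x‖ ≤ B :=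
        le_iSup₂ (f := fun (ψ : (Fin d → ℕ) → (Fin d → ℝ) → ℂ)
            (_ : MemLc0 ψ ∧ lc0Norm p' ψ ≤ 1) =>
          ENNReal.ofReal ‖∑' k, ∫ x : Fin d → ℝ, g k x * ψ k x‖) ((c : ℂ) • ψ) ⟨hmem, hn⟩
      have hval : c * I.toReal = I.toReal ^ (1 / p) := by
        simp only [c]
        rw [mul_comm, ← Real.rpow_one_add' hIr.le]
        · congr 1
          have := hc.inv_add_inv_eq_one
          simp only [one_div]; linarith
        · have := hc.inv_add_inv_eq_one
          have h2 : 0 < p⁻¹ := by positivity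
          simp only [one_div]; intro h; linarith
      rw [hv, hval, Complex.norm_real, Real.norm_of_nonneg (by positivity),
        ← ENNReal.ofReal_rpow_of_pos hIr, ENNReal.ofReal_toReal hIf.ne] at hle
      calc I = (I ^ (1 / p)) ^ p := by rw [← ENNReal.rpow_mul]; field_simp; simp
        _ ≤ B ^ p := by gcongr
    refine (lpl1_le hp g hg _ key).trans_eq ?_
    rw [← ENNReal.rpow_mul]; field_simp; simp

lemma memLc0_single {d : ℕ} (k : Fin d → ℕ) (f : (Fin d → ℝ) → ℂ)
    (hf : AEStronglyMeasurable f volume) : MemLc0 (Pi.single k f) := by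
  classical
  refine ⟨fun j => ?_, Eventually.of_forall fun x => ?_⟩
  · by_cases hj : j = k
    · subst hj; simpa using hf
    · rw [Pi.single_eq_of_ne hj]; exact aestronglyMeasurable_zero
  · refine tendsto_const_nhds.congr' ?_
    have : ∀ᶠ j in (cofinite : Filter (Fin d → ℕ)), j ∉ ({k} : Set (Fin d → ℕ)) :=
      (Set.finite_singleton k).compl_mem_cofinite
    filter_upwards [this] with j hj
    rw [Pi.single_eq_of_ne (by simpa using hj)]
    simp

lemma lc0Norm_single {d : ℕ} (p' : ℝ) (k : Fin d → ℕ) (f : (Fin d → ℝ) → ℂ) :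
    lc0Norm p' (Pi.single k f) = (∫⁻ x, ‖f x‖ₑ ^ p') ^ (1 / p') := by
  classical
  unfold lc0Norm
  congr 2
  ext x
  congr 1
  apply le_antisymm
  · refine iSup_le fun j => ?_
    by_cases hj : j = k
    · subst hj; simp [enorm_eq_nnnorm]
    · simp [Pi.single_eq_of_ne hj]
  · refine le_trans ?_ (le_iSup _ k)
    simp [enorm_eq_nnnorm]

lemma part_c {d : ℕ} {p p' : ℝ} (hc : p.HolderConjugate p')
    (F : ((Fin d → ℕ) → (Fin d → ℝ) → ℂ) →ₗ[ℂ] ℂ) (C : ℝ) (hC : 0 ≤ C)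
    (hF : ∀ ψ : (Fin d → ℕ) → (Fin d → ℝ) → ℂ, MemLc0 ψ → lc0Norm p' ψ < ∞ →
        ‖F ψ‖ ≤ C * (lc0Norm p' ψ).toReal) :
      ∃ g : (Fin d → ℕ) → (Fin d → ℝ) → ℂ,
        (∀ k, AEStronglyMeasurable (g k) volume) ∧
        lpl1Norm p g ≤ ENNReal.ofReal C ∧
        ∀ ψ : (Fin d → ℕ) → (Fin d → ℝ) → ℂ, MemLc0 ψ → lc0Norm p' ψ < ∞ →
          F ψ = ∑' k, ∫ x : Fin d → ℝ, g k x * ψ k x := by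
  classical
  have hp : 0 < p := hc.pos
  have hp' : 0 < p' := hc.symm.pos
  -- finiteness of the norm
  have hfin : ∀ I : ℝ≥0∞, I < ∞ → I ^ (1 / p') < ∞ := fun I hI =>
    ENNReal.rpow_lt_top_of_nonneg (by positivity) hI.ne
  -- a strictly positive function in `L^{p'}`
  obtain ⟨h, hpos, hhm, hhI⟩ : ∃ h : (Fin d → ℝ) → ℝ, (∀ x, 0 < h x) ∧ Measurable h ∧
      ∫⁻ x, ‖((h x : ℝ) : ℂ)‖ₑ ^ p' < ∞ := by
    obtain ⟨w, hw, hwm, hwI⟩ := exists_pos_lintegral_lt_of_sigmaFinite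
      (volume : Measure (Fin d → ℝ)) one_ne_zero
    refine ⟨fun x => (w x : ℝ) ^ (1 / p'), fun x => Real.rpow_pos_of_pos (hw x) _,
      (measurable_coe_nnreal_real.comp hwm).pow_const _, ?_⟩
    refine lt_of_le_of_lt (le_of_eq ?_) (hwI.trans ENNReal.one_lt_top)
    congr 1
    ext x
    have : (0:ℝ) < w x := hw x
    rw [← ofReal_norm, Complex.norm_real, Real.norm_of_nonneg (by positivity),
      ENNReal.ofReal_rpow_of_nonneg (by positivity) hp'.le, ← Real.rpow_mul this.le]
    field_simp
    simp
  let hC' : (Fin d → ℝ) → ℂ := fun x => (h x : ℂ)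
  have hCm : Measurable hC' := Complex.measurable_ofReal.comp hhm
  -- scalar representations
  have hscal : ∀ k f, AEStronglyMeasurable f volume → ∫⁻ x, ‖f x‖ₑ ^ p' < ∞ →
      ‖F (Pi.single k f)‖ ≤ C * ((∫⁻ x, ‖f x‖ₑ ^ p') ^ (1 / p')).toReal := by
    intro k f hf hfi
    rw [← lc0Norm_single p' k f]
    refine hF _ (memLc0_single k f hf) ?_
    rw [lc0Norm_single]
    exact hfin _ hfi
  have hrep := fun k => scalar_rep (μ := (volume : Measure (Fin d → ℝ))) hp'
    (F ∘ₗ LinearMap.single ℂ (fun _ : Fin d → ℕ => (Fin d → ℝ) → ℂ) k)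
    (fun f hf hfi => hscal k f hf hfi) hC' hCm hhI
  choose r hrm hri hr using hrep
  let g : (Fin d → ℕ) → (Fin d → ℝ) → ℂ := fun k x => r k x / h x
  have hgm : ∀ k, Measurable (g k) := fun k => (hrm k).div hCm
  have hg : ∀ k, AEStronglyMeasurable (g k) volume := fun k => (hgm k).aestronglyMeasurable
  have hrep : ∀ k f (n : ℝ), AEStronglyMeasurable f volume → (∀ x, ‖f x‖ ≤ n * h x) →
      F (Pi.single k f) = ∫ x, g k x * f x := by
    intro k f n hf hn
    have := hr k (fun x => f x / h x) n
      (hf.aemeasurable.div hCm.aemeasurable).aestronglyMeasurable (fun x => by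
        rw [norm_div, Complex.norm_real, Real.norm_of_nonneg (hpos x).le, div_le_iff₀ (hpos x)]
        exact hn x)
    have hne : ∀ x, (h x : ℂ) ≠ 0 := fun x => by exact_mod_cast (hpos x).ne'
    have e1 : (fun x => f x / h x * hC' x) = f := by
      ext x
      exact div_mul_cancel₀ _ (hne x)
    rw [e1] at this
    refine this.trans ?_
    congr 1
    ext x
    simp only [g]
    ring
  have hsum : ∀ (S : Finset (Fin d → ℕ)) (ψ : (Fin d → ℕ) → (Fin d → ℝ) → ℂ),
      (∀ k, k ∉ S → ψ k = 0) → ψ = ∑ k ∈ S, Pi.single k (ψ k) := by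
    intro S ψ hS
    ext1 j
    rw [Finset.sum_apply]
    by_cases hj : j ∈ S
    · rw [Finset.sum_eq_single_of_mem j hj]
      · simp
      · intro b _ hb
        exact Pi.single_eq_of_ne hb.symm _
    · rw [hS j hj, Finset.sum_eq_zero]
      intro b hb
      have hne : j ≠ b := fun e => hj (by rw [e]; exact hb)
      exact Pi.single_eq_of_ne hne _
  -- the norm bound
  have hbound : ∀ S : Finset (Fin d → ℕ),
      ∫⁻ x, (∑ k ∈ S, ‖g k x‖ₑ) ^ p ≤ ENNReal.ofReal C ^ p := by
    intro S
    let A : (Fin d → ℝ) → ℝ := fun x => ∑ k ∈ S, ‖g k x‖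
    have hA0 : ∀ x, 0 ≤ A x := fun x => Finset.sum_nonneg fun k _ => norm_nonneg _
    have hAm : Measurable A := Finset.measurable_fun_sum S fun k _ => (hgm k).norm
    have hAe : ∀ x, ∑ k ∈ S, ‖g k x‖ₑ = ENNReal.ofReal (A x) := by
      intro x
      simp only [A]
      rw [ENNReal.ofReal_sum_of_nonneg (fun k _ => norm_nonneg _)]
      simp
    let E : ℕ → Set (Fin d → ℝ) := fun n => {x | A x ^ (p - 1) ≤ n * h x}
    have hEm : ∀ n, MeasurableSet (E n) := fun n =>
      measurableSet_le (hAm.pow_const _) (hhm.const_mul _)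
    have hEmono : Monotone E := by
      intro m n hmn x hx
      have hx' : A x ^ (p - 1) ≤ m * h x := hx
      change A x ^ (p - 1) ≤ n * h x
      refine hx'.trans ?_
      have := (hpos x).le
      gcongr
    have hEu : ⋃ n, E n = Set.univ := by
      refine Set.eq_univ_of_forall fun x => Set.mem_iUnion.2 ?_
      obtain ⟨n, hn⟩ := exists_nat_ge (A x ^ (p - 1) / h x)
      exact ⟨n, (div_le_iff₀ (hpos x)).1 hn⟩
    have hn : ∀ n, ∫⁻ x in E n, (∑ k ∈ S, ‖g k x‖ₑ) ^ p ≤ ENNReal.ofReal C ^ p := by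
      intro n
      set I := ∫⁻ x in E n, (∑ k ∈ S, ‖g k x‖ₑ) ^ p with hI
      have hIf : I < ∞ := by
        have : I ≤ ∫⁻ x, ENNReal.ofReal n ^ p' * ‖((h x : ℝ) : ℂ)‖ₑ ^ p' := by
          refine le_trans ?_ (setLIntegral_le_lintegral (E n) _)
          refine setLIntegral_mono' (hEm n) fun x hx => ?_
          have hx' : A x ^ (p - 1) ≤ n * h x := hx
          rw [hAe, ← ENNReal.mul_rpow_of_nonneg _ _ hp'.le, ← ofReal_norm, Complex.norm_real,
            Real.norm_of_nonneg (hpos x).le, ← ENNReal.ofReal_mul (by positivity),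
            ENNReal.ofReal_rpow_of_nonneg (hA0 x) hp.le, ← hc.sub_one_mul_conj,
            Real.rpow_mul (hA0 x), ← ENNReal.ofReal_rpow_of_nonneg (Real.rpow_nonneg (hA0 x) _) hp'.le]
          gcongr
        refine this.trans_lt ?_
        rw [lintegral_const_mul' _ _ (by finiteness)]
        exact ENNReal.mul_lt_top (by finiteness) hhI
      rcases eq_or_ne I 0 with h0 | h0
      · rw [h0]; exact zero_le
      obtain ⟨ψ, hψ, hψn, hψS, hψE, hψb, hψI⟩ := norming hc g hg S (E n) (hEm n) I rfl hIf
      have hFψ : F ψ = (I.toReal : ℂ) := by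
        rw [hsum S ψ hψS, map_sum, ← hψI]
        refine Finset.sum_congr rfl fun k _ => ?_
        refine hrep k (ψ k) n (hψ.1 k) fun x => ?_
        by_cases hx : x ∈ E n
        · exact (hψb k x).trans hx
        · rw [hψE k x hx, norm_zero]
          have := (hpos x).le
          positivity
      have h1 := hF ψ hψ (hψn.trans_lt (hfin _ hIf))
      have hIr : 0 < I.toReal := ENNReal.toReal_pos h0 hIf.ne
      rw [hFψ, Complex.norm_real, Real.norm_of_nonneg hIr.le] at h1
      have h2 : I.toReal ≤ C * I.toReal ^ (1 / p') := by
        refine h1.trans ?_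
        rw [ENNReal.toReal_rpow]
        gcongr
        exact (hfin _ hIf).ne
      have h3 : I.toReal ^ (1 / p) ≤ C := by
        have e : I.toReal = I.toReal ^ (1 / p) * I.toReal ^ (1 / p') := by
          rw [← Real.rpow_add hIr, one_div, one_div, hc.inv_add_inv_eq_one, Real.rpow_one]
        have hpos2 : 0 < I.toReal ^ (1 / p') := Real.rpow_pos_of_pos hIr _
        refine le_of_mul_le_mul_right ?_ hpos2
        rwa [← e]
      calc I = ENNReal.ofReal (I.toReal ^ (1 / p)) ^ p := by
            rw [← ENNReal.ofReal_rpow_of_pos hIr, ENNReal.ofReal_toReal hIf.ne, ← ENNReal.rpow_mul]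
            field_simp; simp
        _ ≤ _ := by gcongr
    rw [← setLIntegral_univ, ← hEu, setLIntegral_iUnion_of_directed _ hEmono.directed_le]
    exact iSup_le hn
  have hnorm : lpl1Norm p g ≤ ENNReal.ofReal C := by
    refine (lpl1_le hp g hg _ hbound).trans_eq ?_
    rw [← ENNReal.rpow_mul]; field_simp; simp
  refine ⟨g, hg, hnorm, fun ψ hψ hψf => ?_⟩
  have hMI : ∫⁻ x, (⨆ k, (‖ψ k x‖₊ : ℝ≥0∞)) ^ p' < ∞ :=
    (ENNReal.rpow_lt_top_iff_of_pos (by positivity)).1 hψf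
  have hψle : ∀ k x, ‖ψ k x‖ₑ ≤ ⨆ k, (‖ψ k x‖₊ : ℝ≥0∞) := fun k x =>
    le_iSup (fun k => (‖ψ k x‖₊ : ℝ≥0∞)) k
  have hint : ∀ k, Integrable (fun x => g k x * ψ k x) volume := by
    intro k
    refine ⟨(hg k).mul (hψ.1 k), ?_⟩
    have h1 := holder_part hc g ψ hg hψ.1
    refine lt_of_le_of_lt ?_ (h1.trans_lt (ENNReal.mul_lt_top (hnorm.trans_lt (by finiteness)) hψf))
    refine le_trans (le_of_eq ?_) (ENNReal.le_tsum k)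
    congr 1
    ext x
    rw [enorm_mul]; rfl
  have hone : ∀ k, F (Pi.single k (ψ k)) = ∫ x, g k x * ψ k x := by
    intro k
    let E : ℕ → Set (Fin d → ℝ) := fun n => {x | ‖ψ k x‖ ≤ n * h x}
    have hEm : ∀ n, NullMeasurableSet (E n) volume := fun n =>
      nullMeasurableSet_le (hψ.1 k).norm.aemeasurable (hhm.const_mul _).aemeasurable
    have hEv : ∀ x, ∀ᶠ n in atTop, x ∈ E n := by
      intro x
      obtain ⟨n, hn⟩ := exists_nat_ge (‖ψ k x‖ / h x)
      filter_upwards [eventually_ge_atTop n] with m hm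
      have h1 : (n : ℝ) ≤ m := by exact_mod_cast hm
      exact (div_le_iff₀ (hpos x)).1 (hn.trans h1)
    have hθm : ∀ n, AEStronglyMeasurable ((E n).indicator (ψ k)) volume := fun n =>
      (hψ.1 k).indicator₀ (hEm n)
    have hθ : ∀ n, F (Pi.single k ((E n).indicator (ψ k)))
        = ∫ x, g k x * (E n).indicator (ψ k) x := by
      intro n
      refine hrep k _ n (hθm n) fun x => ?_
      by_cases hx : x ∈ E n
      · rw [Set.indicator_of_mem hx]; exact hx
      · rw [Set.indicator_of_notMem hx, norm_zero]
        have := (hpos x).le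
        positivity
    have l1 : Tendsto (fun n => F (Pi.single k ((E n).indicator (ψ k)))) atTop
        (nhds (F (Pi.single k (ψ k)))) := by
      rw [← tendsto_sub_nhds_zero_iff]
      refine core_tendsto (μ := (volume : Measure (Fin d → ℝ))) (C := C) hp' _
        (fun n x => ‖((E n).indicator (ψ k) - ψ k) x‖ₑ) (fun x => ⨆ k, (‖ψ k x‖₊ : ℝ≥0∞)) hMI
        (fun n => ((hθm n).sub (hψ.1 k)).enorm) ?_ ?_ ?_
      · intro n
        refine Eventually.of_forall fun x => ?_
        by_cases hx : x ∈ E n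
        · simp [hx]
        · simp only [Pi.sub_apply, hx, not_false_eq_true, Set.indicator_of_notMem, zero_sub,
            enorm_neg]
          exact hψle k x
      · refine Eventually.of_forall fun x => tendsto_const_nhds.congr' ?_
        filter_upwards [hEv x] with n hn
        simp [hn]
      · intro n hn
        rw [← map_sub, ← Pi.single_sub]
        exact hscal k _ ((hθm n).sub (hψ.1 k)) hn
    have l2 : Tendsto (fun n => ∫ x, g k x * (E n).indicator (ψ k) x) atTop
        (nhds (∫ x, g k x * ψ k x)) := by
      refine tendsto_integral_of_dominated_convergence (fun x => ‖g k x * ψ k x‖)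
        (fun n => (hg k).mul (hθm n)) (hint k).norm (fun n => Eventually.of_forall fun x => ?_) ?_
      · rw [norm_mul, norm_mul]
        gcongr
        exact norm_indicator_le_norm_self _ _
      · refine Eventually.of_forall fun x => tendsto_const_nhds.congr' ?_
        filter_upwards [hEv x] with n hn
        simp [hn]
    simp_rw [hθ] at l1
    exact tendsto_nhds_unique l1 l2
  refine (HasSum.tsum_eq ?_).symm
  let cut : Finset (Fin d → ℕ) → (Fin d → ℕ) → (Fin d → ℝ) → ℂ := fun S k => if k ∈ S then ψ k else 0
  have hcut : ∀ S, F (cut S) = ∑ k ∈ S, ∫ x, g k x * ψ k x := by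
    intro S
    rw [hsum S (cut S) (fun k hk => if_neg hk), map_sum]
    refine Finset.sum_congr rfl fun k hk => ?_
    rw [← hone k]
    simp [cut, hk]
  have hcm : ∀ S k, AEStronglyMeasurable ((cut S - ψ) k) volume := by
    intro S k
    by_cases hk : k ∈ S
    · simp [cut, hk, aestronglyMeasurable_zero]
    · simpa [cut, hk] using (hψ.1 k).neg
  have hcn : ∀ S k x, ‖(cut S - ψ) k x‖ ≤ ‖ψ k x‖ := by
    intro S k x
    by_cases hk : k ∈ S <;> simp [cut, hk]
  have hlim : Tendsto (fun S => F (cut S)) atTop (nhds (F ψ)) := by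
    rw [← tendsto_sub_nhds_zero_iff]
    refine core_tendsto (μ := (volume : Measure (Fin d → ℝ))) (C := C) hp' _
        (fun S x => ⨆ k, (‖(cut S - ψ) k x‖₊ : ℝ≥0∞)) (fun x => ⨆ k, (‖ψ k x‖₊ : ℝ≥0∞)) hMI
        (fun S => AEMeasurable.iSup fun k => (hcm S k).enorm) ?_ ?_ ?_
    · intro S
      refine Eventually.of_forall fun x => iSup_mono fun k => ?_
      exact_mod_cast hcn S k x
    · filter_upwards [hψ.2] with x hx
      rw [ENNReal.tendsto_nhds_zero]
      intro ε hε
      have hx2 : Tendsto (fun k => ‖ψ k x‖ₑ) cofinite (nhds 0) := by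
        have := ENNReal.tendsto_ofReal hx
        simpa using this
      have hev := (ENNReal.tendsto_nhds_zero.1 hx2) ε hε
      rw [eventually_cofinite] at hev
      filter_upwards [eventually_ge_atTop hev.toFinset] with S hS
      refine iSup_le fun k => ?_
      by_cases hk : k ∈ S
      · simp [cut, hk]
      · have h1 : ‖ψ k x‖ₑ ≤ ε := by
          by_contra hcon
          exact hk (hS (by simpa using hcon))
        refine le_trans ?_ h1
        exact_mod_cast hcn S k x
    · intro S hS
      rw [← map_sub]
      refine hF (cut S - ψ) ⟨hcm S, ?_⟩ (hfin _ hS)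
      filter_upwards [hψ.2] with x hx
      exact squeeze_zero (fun k => norm_nonneg _) (fun k => hcn S k x) hx
  simp_rw [hcut] at hlim
  exact hlim

theorem stmt_18 (d : ℕ) (p p' : ℝ) (hp : 1 < p) (hpp' : 1 / p + 1 / p' = 1) :
    -- the canonical pairing is a linear isometry from `L^p(ℓ¹)` into `(L^{p'}(c₀))'` ...
    (∀ g : (Fin d → ℕ) → (Fin d → ℝ) → ℂ,
      (∀ k, AEStronglyMeasurable (g k) volume) → lpl1Norm p g < ∞ →
        (∀ ψ : (Fin d → ℕ) → (Fin d → ℝ) → ℂ, MemLc0 ψ →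
          (∑' k, ∫⁻ x, (‖g k x‖₊ : ℝ≥0∞) * (‖ψ k x‖₊ : ℝ≥0∞))
            ≤ lpl1Norm p g * lc0Norm p' ψ) ∧
        (⨆ (ψ : (Fin d → ℕ) → (Fin d → ℝ) → ℂ)
            (_ : MemLc0 ψ ∧ lc0Norm p' ψ ≤ 1),
          ENNReal.ofReal ‖∑' k, ∫ x : Fin d → ℝ, g k x * ψ k x‖) = lpl1Norm p g) ∧
    -- ... and every continuous linear functional on `L^{p'}(c₀)` arises in this way.
    (∀ (F : ((Fin d → ℕ) → (Fin d → ℝ) → ℂ) →ₗ[ℂ] ℂ) (C : ℝ), 0 ≤ C →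
      (∀ ψ : (Fin d → ℕ) → (Fin d → ℝ) → ℂ, MemLc0 ψ → lc0Norm p' ψ < ∞ →
        ‖F ψ‖ ≤ C * (lc0Norm p' ψ).toReal) →
      ∃ g : (Fin d → ℕ) → (Fin d → ℝ) → ℂ,
        (∀ k, AEStronglyMeasurable (g k) volume) ∧
        lpl1Norm p g ≤ ENNReal.ofReal C ∧
        ∀ ψ : (Fin d → ℕ) → (Fin d → ℝ) → ℂ, MemLc0 ψ → lc0Norm p' ψ < ∞ →
          F ψ = ∑' k, ∫ x : Fin d → ℝ, g k x * ψ k x) := by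
  have hc : p.HolderConjugate p' := by
    rw [Real.holderConjugate_iff]
    exact ⟨hp, by simpa using hpp'⟩
  refine ⟨fun g hg hgf => ⟨fun ψ hψ => holder_part hc g ψ hg hψ.1, part_b hc g hg hgf⟩, ?_⟩
  intro F C hC hF
  exact part_c hc F C hC hF
end
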